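/- Let G be an affine reductive algebraic group over an algebraically closed field k of characteristic zero and X an affine G-variety such that G_X is finite. Then for any x ∈ X the three notions stable, properly stable, and 1PS stable are all equivalent. -/

import Mathlib

open scoped MatrixGroups

namespace PaperGIT

variable {k : Type} [Field k]

/-- The zero locus in affine space `k^σ` of a set of polynomials. -/
def zeroLocus {σ : Type} (I : Set (MvPolynomial σ k)) : Set (σ → k) :=
  {x | ∀ f ∈ I, MvPolynomial.eval x f = 0}

/-- A subset of affine space is Zariski closed if it is the zero locus of a set
of polynomials. -/
def IsZClosed {σ : Type} (S : Set (σ → k)) : Prop :=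
  ∃ I : Set (MvPolynomial σ k), S = zeroLocus I

/-- The Zariski closure of a subset of affine space. -/
def zClosure {σ : Type} (S : Set (σ → k)) : Set (σ → k) :=
  ⋂₀ {C | IsZClosed C ∧ S ⊆ C}

/-- A matrix viewed as a point of affine space. -/
def mat2pt {n : ℕ} (A : Matrix (Fin n) (Fin n) k) : Fin n × Fin n → k :=
  fun p => A p.1 p.2

/-- An affine algebraic group over `k`, realized (as is always possible) as a
Zariski closed subgroup of some `GL n k`. -/
structure AlgGroup (k : Type) [Field k] where
  n : ℕ
  toSubgroup : Subgroup (GL (Fin n) k)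
  closed : ∃ I : Set (MvPolynomial (Fin n × Fin n) k),
    ∀ A : GL (Fin n) k, A ∈ toSubgroup ↔
      mat2pt (A : Matrix (Fin n) (Fin n) k) ∈ zeroLocus I

/-- A one-parameter subgroup (cocharacter) of `G`: a group homomorphism
`k^× → G` whose matrix entries are Laurent polynomials in the parameter. -/
structure OnePS (G : AlgGroup k) where
  toFun : kˣ →* GL (Fin G.n) k
  mem : ∀ t : kˣ, toFun t ∈ G.toSubgroup
  regular : ∃ p : Fin G.n × Fin G.n → MvPolynomial Bool k,
    ∀ (t : kˣ) (ij : Fin G.n × Fin G.n),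
      (toFun t : Matrix (Fin G.n) (Fin G.n) k) ij.1 ij.2 =
        MvPolynomial.eval (fun b => if b then (t : k) else ((t⁻¹ : kˣ) : k)) (p ij)

/-- `GLimit lam g h` says that the morphism `t ↦ lam(t) * g * lam(t)⁻¹` of `k^×`
into `G` extends to a morphism `k → G` with value `h` at `t = 0`; i.e. that
`lam⁺g = lim_{t→0} lam(t) g lam(t)⁻¹` exists and equals `h`. -/
def GLimit {G : AlgGroup k} (lam : OnePS G) (g h : GL (Fin G.n) k) : Prop :=
  h ∈ G.toSubgroup ∧
  ∃ q : Fin G.n × Fin G.n → Polynomial k,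
    (∀ (t : kˣ) (ij : Fin G.n × Fin G.n),
      ((lam.toFun t * g * (lam.toFun t)⁻¹ : GL (Fin G.n) k) :
          Matrix (Fin G.n) (Fin G.n) k) ij.1 ij.2 = (q ij).eval (t : k)) ∧
    ∀ ij : Fin G.n × Fin G.n,
      (h : Matrix (Fin G.n) (Fin G.n) k) ij.1 ij.2 = (q ij).eval 0

/-- The R-parabolic subgroup `P(λ) = {g ∈ G : lim_{t→0} λ(t) g λ(t)⁻¹ exists}`. -/
def Pset {G : AlgGroup k} (lam : OnePS G) : Set (GL (Fin G.n) k) :=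
  {g | g ∈ G.toSubgroup ∧ ∃ h, GLimit lam g h}

/-- The R-Levi subgroup `L(λ) = {g ∈ G : lim_{t→0} λ(t) g λ(t)⁻¹ = g}`. -/
def Lset {G : AlgGroup k} (lam : OnePS G) : Set (GL (Fin G.n) k) :=
  {g | g ∈ G.toSubgroup ∧ GLimit lam g g}

/-- `L` is an R-Levi subgroup of the R-parabolic subgroup `P`, i.e. `L = L(μ)`
for some one-parameter subgroup `μ` with `P(μ) = P`. -/
def IsRLeviOf {G : AlgGroup k} (L P : Set (GL (Fin G.n) k)) : Prop :=
  ∃ mu : OnePS G, Pset mu = P ∧ Lset mu = L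

/-- `P` is an R-parabolic subgroup of `G`. -/
def IsRParabolic {G : AlgGroup k} (P : Set (GL (Fin G.n) k)) : Prop :=
  ∃ lam : OnePS G, P = Pset lam

/-- Two one-parameter subgroups are opposite if `P(λ) ∩ P(λ')` is an R-Levi
subgroup of both `P(λ)` and `P(λ')`. -/
def AreOpposite {G : AlgGroup k} (lam lam' : OnePS G) : Prop :=
  IsRLeviOf (Pset lam ∩ Pset lam') (Pset lam) ∧
  IsRLeviOf (Pset lam ∩ Pset lam') (Pset lam')

/-- A subgroup (given as a subset) `H ⊆ G` is completely reducible in `G` if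
every R-parabolic subgroup of `G` containing `H` has an R-Levi subgroup
containing `H`. -/
def CompletelyReducible (G : AlgGroup k) (H : Set (GL (Fin G.n) k)) : Prop :=
  ∀ lam : OnePS G, H ⊆ Pset lam →
    ∃ L : Set (GL (Fin G.n) k), IsRLeviOf L (Pset lam) ∧ H ⊆ L

/-- A subgroup (given as a subset) `H ⊆ G` is irreducible in `G` if it is not
contained in any proper R-parabolic subgroup of `G`. -/
def IrreducibleIn (G : AlgGroup k) (H : Set (GL (Fin G.n) k)) : Prop :=
  ∀ lam : OnePS G, H ⊆ Pset lam → Pset lam = (G.toSubgroup : Set (GL (Fin G.n) k))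

/-- The center `Z(G)` of `G`, as a subset. -/
def centerSet (G : AlgGroup k) : Set (GL (Fin G.n) k) :=
  {g | g ∈ G.toSubgroup ∧ ∀ h ∈ G.toSubgroup, g * h = h * g}

/-- The centralizer `Z_G(H)` of a subset `H` in `G`. -/
def centralizerSet (G : AlgGroup k) (H : Set (GL (Fin G.n) k)) :
    Set (GL (Fin G.n) k) :=
  {g | g ∈ G.toSubgroup ∧ ∀ h ∈ H, g * h = h * g}

/-- A subset of `GL n k` which is Zariski closed in `GL n k` (with the subspace
topology coming from the space of matrices). -/
def ClosedInGL {n : ℕ} (S : Set (GL (Fin n) k)) : Prop :=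
  ∃ I : Set (MvPolynomial (Fin n × Fin n) k),
    S = {A : GL (Fin n) k | mat2pt (A : Matrix (Fin n) (Fin n) k) ∈ zeroLocus I}

/-- Zariski connectedness (preconnectedness) of a subset of `GL n k`. -/
def IsConnSet {n : ℕ} (T : Set (GL (Fin n) k)) : Prop :=
  ∀ V W : Set (GL (Fin n) k), ClosedInGL V → ClosedInGL W →
    T ⊆ V ∪ W → T ∩ V ∩ W = ∅ → T ⊆ V ∨ T ⊆ W

/-- The connected component of the identity of `G`. -/
def idComponent (G : AlgGroup k) : Set (GL (Fin G.n) k) :=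
  ⋃₀ {C | C ⊆ (G.toSubgroup : Set (GL (Fin G.n) k)) ∧
      (1 : GL (Fin G.n) k) ∈ C ∧ IsConnSet C}

/-- A unipotent element of `GL n k`. -/
def IsUnipotentEl {n : ℕ} (A : GL (Fin n) k) : Prop :=
  ((A : Matrix (Fin n) (Fin n) k) - 1) ^ n = 0

/-- `G` is reductive: the unipotent radical of the identity component `G⁰` is
trivial, i.e. every connected normal subgroup of `G⁰` consisting of unipotent
elements is trivial. -/
def IsReductive (G : AlgGroup k) : Prop :=
  ∀ H : Set (GL (Fin G.n) k),
    H ⊆ idComponent G → (1 : GL (Fin G.n) k) ∈ H →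
    (∀ a ∈ H, ∀ b ∈ H, a * b ∈ H) → (∀ a ∈ H, a⁻¹ ∈ H) →
    (∀ g ∈ idComponent G, ∀ h ∈ H, g * h * g⁻¹ ∈ H) →
    IsConnSet H → (∀ h ∈ H, IsUnipotentEl h) →
    H = {1}

/-- A semisimple (diagonalizable) element of `GL n k`. -/
def IsSemisimpleEl {n : ℕ} (A : GL (Fin n) k) : Prop :=
  ∃ P : GL (Fin n) k,
    ((P * A * P⁻¹ : GL (Fin n) k) : Matrix (Fin n) (Fin n) k).IsDiag

/-- A torus in `G`: a Zariski closed connected commutative subgroup all of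
whose elements are semisimple. -/
def IsTorusIn (G : AlgGroup k) (T : Set (GL (Fin G.n) k)) : Prop :=
  T ⊆ (G.toSubgroup : Set (GL (Fin G.n) k)) ∧ (1 : GL (Fin G.n) k) ∈ T ∧
  (∀ a ∈ T, ∀ b ∈ T, a * b ∈ T) ∧ (∀ a ∈ T, a⁻¹ ∈ T) ∧
  ClosedInGL T ∧ IsConnSet T ∧
  (∀ a ∈ T, ∀ b ∈ T, a * b = b * a) ∧
  (∀ a ∈ T, IsSemisimpleEl a)

/-- A maximal torus of `G`. -/
def IsMaximalTorusIn (G : AlgGroup k) (T : Set (GL (Fin G.n) k)) : Prop :=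
  IsTorusIn G T ∧ ∀ T' : Set (GL (Fin G.n) k), IsTorusIn G T' → T ⊆ T' → T' = T

/-- A morphism of affine algebraic groups: a group homomorphism on the points
of `G` whose matrix entries are regular functions on `G`. -/
structure AlgGroupHom (G G' : AlgGroup k) where
  toFun : GL (Fin G.n) k → GL (Fin G'.n) k
  mem : ∀ g ∈ G.toSubgroup, toFun g ∈ G'.toSubgroup
  map_one : toFun 1 = 1
  map_mul : ∀ g ∈ G.toSubgroup, ∀ h ∈ G.toSubgroup, toFun (g * h) = toFun g * toFun h
  regular : ∃ p : Fin G'.n × Fin G'.n → MvPolynomial ((Fin G.n × Fin G.n) ⊕ Unit) k,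
    ∀ g ∈ G.toSubgroup, ∀ ij : Fin G'.n × Fin G'.n,
      (toFun g : Matrix (Fin G'.n) (Fin G'.n) k) ij.1 ij.2 =
        MvPolynomial.eval
          (Sum.elim (mat2pt (g : Matrix (Fin G.n) (Fin G.n) k))
            (fun _ => ((g⁻¹ : GL (Fin G.n) k) : Matrix (Fin G.n) (Fin G.n) k).det))
          (p ij)

/-- Surjectivity of a morphism of algebraic groups (onto the points of `G'`). -/
def AlgGroupHom.Surj {G G' : AlgGroup k} (f : AlgGroupHom G G') : Prop :=
  ∀ g' ∈ G'.toSubgroup, ∃ g ∈ G.toSubgroup, f.toFun g = g'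

/-- An affine `G`-variety: a Zariski closed subset of affine space `k^m`
together with an algebraic (polynomially defined) action of `G`. -/
structure GVariety (G : AlgGroup k) (m : ℕ) where
  carrier : Set (Fin m → k)
  closed : IsZClosed carrier
  act : GL (Fin G.n) k → (Fin m → k) → (Fin m → k)
  act_mem : ∀ g ∈ G.toSubgroup, ∀ x ∈ carrier, act g x ∈ carrier
  act_one : ∀ x ∈ carrier, act 1 x = x
  act_mul : ∀ g ∈ G.toSubgroup, ∀ h ∈ G.toSubgroup, ∀ x ∈ carrier,
    act (g * h) x = act g (act h x)
  regular : ∃ p : Fin m → MvPolynomial ((Fin G.n × Fin G.n) ⊕ (Unit ⊕ Fin m)) k,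
    ∀ g ∈ G.toSubgroup, ∀ x ∈ carrier, ∀ i : Fin m,
      act g x i =
        MvPolynomial.eval
          (Sum.elim (mat2pt (g : Matrix (Fin G.n) (Fin G.n) k))
            (Sum.elim
              (fun _ => ((g⁻¹ : GL (Fin G.n) k) : Matrix (Fin G.n) (Fin G.n) k).det)
              x))
          (p i)

/-- `XLimit X lam x y` : the `lam`-ray through `x`, `t ↦ lam(t)·x`, extends to
a morphism `k → X` with value `y` at `0`; i.e. `lam⁺x` exists and equals `y`. -/
def XLimit {G : AlgGroup k} {m : ℕ} (X : GVariety G m) (lam : OnePS G)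
    (x y : Fin m → k) : Prop :=
  y ∈ X.carrier ∧
  ∃ q : Fin m → Polynomial k,
    (∀ (t : kˣ) (i : Fin m), X.act (lam.toFun t) x i = (q i).eval (t : k)) ∧
    ∀ i : Fin m, y i = (q i).eval 0

/-- `lam ∈ Λ_x` : the limit `lam⁺x` exists. -/
def InLambda {G : AlgGroup k} {m : ℕ} (X : GVariety G m) (x : Fin m → k)
    (lam : OnePS G) : Prop :=
  ∃ y, XLimit X lam x y

/-- `H_x = ∩_{λ ∈ Λ_x} P(λ)`. -/
def Hx {G : AlgGroup k} {m : ℕ} (X : GVariety G m) (x : Fin m → k) :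
    Set (GL (Fin G.n) k) :=
  {g | g ∈ G.toSubgroup ∧ ∀ lam : OnePS G, InLambda X x lam → g ∈ Pset lam}

/-- `Λ_x` is symmetric: every `λ ∈ Λ_x` admits an opposite `λ' ∈ Λ_x`. -/
def SymmetricLambda {G : AlgGroup k} {m : ℕ} (X : GVariety G m)
    (x : Fin m → k) : Prop :=
  ∀ lam : OnePS G, InLambda X x lam →
    ∃ lam' : OnePS G, InLambda X x lam' ∧ AreOpposite lam lam'

/-- The map `η : X → S(G)`, `x ↦ H_x`, is proper: `H_x ⊆ P(λ)` implies `λ ∈ Λ_x`. -/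
def EtaProper {G : AlgGroup k} {m : ℕ} (X : GVariety G m) : Prop :=
  ∀ x ∈ X.carrier, ∀ lam : OnePS G, Hx X x ⊆ Pset lam → InLambda X x lam

/-- The `G`-orbit of `x`. -/
def orbitSet {G : AlgGroup k} {m : ℕ} (X : GVariety G m) (x : Fin m → k) :
    Set (Fin m → k) :=
  {y | ∃ g ∈ G.toSubgroup, y = X.act g x}

/-- `x` is polystable: its `G`-orbit is Zariski closed. -/
def Polystable {G : AlgGroup k} {m : ℕ} (X : GVariety G m) (x : Fin m → k) : Prop :=
  IsZClosed (orbitSet X x)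

/-- The stabilizer `G_x` of `x`, as a subset of `G`. -/
def stabSet {G : AlgGroup k} {m : ℕ} (X : GVariety G m) (x : Fin m → k) :
    Set (GL (Fin G.n) k) :=
  {g | g ∈ G.toSubgroup ∧ X.act g x = x}

/-- The center of the action, `G_X = ∩_{x ∈ X} G_x`. -/
def actionCenter {G : AlgGroup k} {m : ℕ} (X : GVariety G m) :
    Set (GL (Fin G.n) k) :=
  {g | g ∈ G.toSubgroup ∧ ∀ x ∈ X.carrier, X.act g x = x}

/-- `x` is stable: polystable and `G_x/G_X` is finite (finitely many cosets
`g·G_X` with `g ∈ G_x`). -/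
def Stable {G : AlgGroup k} {m : ℕ} (X : GVariety G m) (x : Fin m → k) : Prop :=
  Polystable X x ∧
  Set.Finite ((fun g => (fun h => g * h) '' actionCenter X) '' stabSet X x)

/-- `x` is properly stable: polystable with finite stabilizer. -/
def ProperlyStable {G : AlgGroup k} {m : ℕ} (X : GVariety G m) (x : Fin m → k) : Prop :=
  Polystable X x ∧ (stabSet X x).Finite

/-- `x` is equicentral: polystable and `G_x = G_X`. -/
def Equicentral {G : AlgGroup k} {m : ℕ} (X : GVariety G m) (x : Fin m → k) : Prop :=
  Polystable X x ∧ stabSet X x = actionCenter X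

/-- `x` is 1PS stable: polystable, and for every one-parameter subgroup `λ`
of `G` with `λ(k^×) ⊄ G_X` the limit `λ⁺x` does not exist. -/
def OnePSStable {G : AlgGroup k} {m : ℕ} (X : GVariety G m) (x : Fin m → k) : Prop :=
  Polystable X x ∧
  ∀ lam : OnePS G, ¬ (∀ t : kˣ, lam.toFun t ∈ actionCenter X) → ¬ InLambda X x lam

/-- The weight space of weight `n ∈ ℤ` for the 1PS `lam` acting on `k^m`. -/
def weightSpace {G : AlgGroup k} {m : ℕ} (X : GVariety G m) (lam : OnePS G)
    (n : ℤ) : Set (Fin m → k) :=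
  {w | ∀ t : kˣ, X.act (lam.toFun t) w = (((t ^ n : kˣ) : k)) • w}

/-- `μ(v, lam) = μ0`: decomposing `v` into nonzero weight vectors for `lam`,
the minimal occurring weight equals `μ0`. -/
def MuIs {G : AlgGroup k} {m : ℕ} (X : GVariety G m) (lam : OnePS G)
    (v : Fin m → k) (μ0 : ℤ) : Prop :=
  ∃ (s : Finset ℤ) (c : ℤ → (Fin m → k)),
    (∀ n ∈ s, c n ∈ weightSpace X lam n ∧ c n ≠ 0) ∧
    v = ∑ n ∈ s, c n ∧ μ0 ∈ s ∧ ∀ n ∈ s, μ0 ≤ n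

/-- `GL n k` itself, as an affine algebraic group. -/
def fullGL (k : Type) [Field k] (n : ℕ) : AlgGroup k where
  n := n
  toSubgroup := ⊤
  closed := ⟨∅, by intro A; simp [zeroLocus]⟩

/-- A subset `X ⊆ G^N` which is Zariski closed in `G^N`. -/
def GNClosed (G : AlgGroup k) (N : ℕ)
    (S : Set (Fin N → GL (Fin G.n) k)) : Prop :=
  ∃ I : Set (MvPolynomial (Fin N × (Fin G.n × Fin G.n)) k),
    S = {x | (∀ i, x i ∈ G.toSubgroup) ∧
          ∀ f ∈ I, MvPolynomial.eval
            (fun p => ((x p.1 : Matrix (Fin G.n) (Fin G.n) k) p.2.1 p.2.2)) f = 0}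

/-- Limits of the `lam`-ray through `x ∈ X ⊆ G^N`, for the simultaneous
conjugation action. -/
def GNLimit {G : AlgGroup k} {N : ℕ} (X : Set (Fin N → GL (Fin G.n) k))
    (lam : OnePS G) (x y : Fin N → GL (Fin G.n) k) : Prop :=
  y ∈ X ∧
  ∃ q : Fin N → Fin G.n × Fin G.n → Polynomial k,
    (∀ (t : kˣ) (i : Fin N) (ij : Fin G.n × Fin G.n),
      ((lam.toFun t * x i * (lam.toFun t)⁻¹ : GL (Fin G.n) k) :
          Matrix (Fin G.n) (Fin G.n) k) ij.1 ij.2 = (q i ij).eval (t : k)) ∧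
    ∀ (i : Fin N) (ij : Fin G.n × Fin G.n),
      (y i : Matrix (Fin G.n) (Fin G.n) k) ij.1 ij.2 = (q i ij).eval 0

/-- `lam ∈ Λ_x` for `x ∈ X ⊆ G^N`. -/
def GNInLambda {G : AlgGroup k} {N : ℕ} (X : Set (Fin N → GL (Fin G.n) k))
    (x : Fin N → GL (Fin G.n) k) (lam : OnePS G) : Prop :=
  ∃ y, GNLimit X lam x y

/-- `H_x` for `x ∈ X ⊆ G^N`. -/
def GNHx {G : AlgGroup k} {N : ℕ} (X : Set (Fin N → GL (Fin G.n) k))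
    (x : Fin N → GL (Fin G.n) k) : Set (GL (Fin G.n) k) :=
  {g | g ∈ G.toSubgroup ∧ ∀ lam : OnePS G, GNInLambda X x lam → g ∈ Pset lam}

/-- `φ_x`: the subgroup of `G` generated by the components of `x ∈ G^N`. -/
def phiSet {G : AlgGroup k} {N : ℕ} (x : Fin N → GL (Fin G.n) k) :
    Set (GL (Fin G.n) k) :=
  (Subgroup.closure (Set.range x) : Subgroup (GL (Fin G.n) k))

/-- The orbit of `x ∈ G^N` under simultaneous conjugation. -/
def GNOrbit {G : AlgGroup k} {N : ℕ} (x : Fin N → GL (Fin G.n) k) :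
    Set (Fin N → GL (Fin G.n) k) :=
  {y | ∃ g ∈ G.toSubgroup, y = fun i => g * x i * g⁻¹}

/-- Polystability of `x ∈ X ⊆ G^N`: the conjugation orbit is Zariski closed. -/
def GNPolystable (G : AlgGroup k) {N : ℕ} (x : Fin N → GL (Fin G.n) k) : Prop :=
  GNClosed G N (GNOrbit x)

/-- The stabilizer of `x ∈ G^N` under simultaneous conjugation. -/
def GNStab (G : AlgGroup k) {N : ℕ} (x : Fin N → GL (Fin G.n) k) :
    Set (GL (Fin G.n) k) :=
  {g | g ∈ G.toSubgroup ∧ ∀ i, g * x i * g⁻¹ = x i}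

/-- `G_X` for `X ⊆ G^N` with the simultaneous conjugation action. -/
def GNActionCenter (G : AlgGroup k) {N : ℕ}
    (X : Set (Fin N → GL (Fin G.n) k)) : Set (GL (Fin G.n) k) :=
  {g | g ∈ G.toSubgroup ∧ ∀ x ∈ X, ∀ i, g * x i * g⁻¹ = x i}

/-- `x ∈ X ⊆ G^N` is stable: polystable and `G_x/G_X` finite. -/
def GNStable (G : AlgGroup k) {N : ℕ} (X : Set (Fin N → GL (Fin G.n) k))
    (x : Fin N → GL (Fin G.n) k) : Prop :=
  GNPolystable G x ∧
  Set.Finite ((fun g => (fun h => g * h) '' GNActionCenter G X) '' GNStab G x)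

/-- `x ∈ X ⊆ G^N` is equicentral: polystable and `G_x = G_X`. -/
def GNEquicentral (G : AlgGroup k) {N : ℕ} (X : Set (Fin N → GL (Fin G.n) k))
    (x : Fin N → GL (Fin G.n) k) : Prop :=
  GNPolystable G x ∧ GNStab G x = GNActionCenter G X

/-- A subgroup `H ⊆ G` is isotropic: completely reducible with `Z_G(H) = Z(G)`. -/
def IsIsotropic (G : AlgGroup k) (H : Set (GL (Fin G.n) k)) : Prop :=
  CompletelyReducible G H ∧ centralizerSet G H = centerSet G



section opsec
variable {k : Type} [Field k] {M : Type*} [AddCommGroup M] [Module k M]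

/-- The generalized eigenspaces of `T` span. -/
def Spans (T : Module.End k M) : Prop := ⨆ μ : k, T.maxGenEigenspace μ = ⊤

theorem spans_internal {T : Module.End k M} (h : Spans T) [DecidableEq k] :
    DirectSum.IsInternal (fun μ : k => T.maxGenEigenspace μ) :=
  DirectSum.isInternal_submodule_of_iSupIndep_of_iSup_eq_top T.independent_maxGenEigenspace h

theorem exists_op (T : Module.End k M) (h : Spans T) (c : k → k) :
    ∃ S : Module.End k M, ∀ μ, ∀ x ∈ T.maxGenEigenspace μ, S x = c μ • x := by
  classical
  have hi := spans_internal h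
  let e := LinearEquiv.ofBijective (DirectSum.coeLinearMap (fun μ : k => T.maxGenEigenspace μ)) hi
  refine ⟨(DirectSum.toModule k k M (fun μ => c μ • (T.maxGenEigenspace μ).subtype)) ∘ₗ
    e.symm.toLinearMap, ?_⟩
  intro μ x hx
  have : e.symm x = DirectSum.lof k k (fun μ : k => T.maxGenEigenspace μ) μ ⟨x, hx⟩ := by
    rw [LinearEquiv.symm_apply_eq]
    exact (DirectSum.coeLinearMap_lof (fun μ : k => T.maxGenEigenspace μ) μ ⟨x, hx⟩).symm
  simp [this]

open Classical in
/-- The operator acting as `c μ` on the generalized eigenspace `μ` of `T`. -/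
noncomputable def op (T : Module.End k M) (c : k → k) : Module.End k M :=
  if h : Spans T then (exists_op T h c).choose else 0

theorem op_apply {T : Module.End k M} (h : Spans T) (c : k → k) {μ : k} {x : M}
    (hx : x ∈ T.maxGenEigenspace μ) : op T c x = c μ • x := by
  rw [op, dif_pos h]
  exact (exists_op T h c).choose_spec μ x hx

theorem spans_induction {T : Module.End k M} (h : Spans T) {P : M → Prop}
    (h1 : ∀ μ, ∀ x ∈ T.maxGenEigenspace μ, P x) (h2 : ∀ x y, P x → P y → P (x + y)) (x : M) : P x := by
  have hx : x ∈ ⨆ μ : k, T.maxGenEigenspace μ := by rw [show _ = _ from h]; trivial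
  refine Submodule.iSup_induction _ (motive := P) hx h1 (h1 0 0 (Submodule.zero_mem _)) h2

theorem op_mul {T : Module.End k M} (h : Spans T) (c d : k → k) :
    op T (fun μ => c μ * d μ) = op T c * op T d := by
  ext x
  induction x using spans_induction h with
  | h1 μ x hx => simp [op_apply h _ hx, mul_smul, smul_comm (c μ) (d μ)]
  | h2 x y hx hy => simp [hx, hy]

theorem op_one {T : Module.End k M} (h : Spans T) : op T (fun _ => 1) = 1 := by
  ext x
  induction x using spans_induction h with
  | h1 μ x hx => simp [op_apply h _ hx]
  | h2 x y hx hy => simp [hx, hy]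

theorem map_maxGen {N : Type*} [AddCommGroup N] [Module k N] {T : Module.End k M}
    {S : Module.End k N} (f : M →ₗ[k] N) (hf : ∀ x, f (T x) = S (f x)) {μ : k} {x : M}
    (hx : x ∈ T.maxGenEigenspace μ) : f x ∈ S.maxGenEigenspace μ := by
  rw [Module.End.mem_maxGenEigenspace] at hx ⊢
  obtain ⟨n, hn⟩ := hx
  refine ⟨n, ?_⟩
  have : ∀ m : ℕ, ∀ y, f (((T - μ • (1 : Module.End k M)) ^ m) y) =
      ((S - μ • (1 : Module.End k N)) ^ m) (f y) := by
    intro m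
    induction m with
    | zero => simp
    | succ m ih => intro y; simp [pow_succ, ih, hf]
  rw [← this, hn, map_zero]

theorem op_comm {N : Type*} [AddCommGroup N] [Module k N] {T : Module.End k M}
    {S : Module.End k N} (hT : Spans T) (hS : Spans S) (f : M →ₗ[k] N)
    (hf : ∀ x, f (T x) = S (f x)) (c : k → k) (x : M) : f (op T c x) = op S c (f x) := by
  induction x using spans_induction hT with
  | h1 μ x hx => simp [op_apply hT _ hx, op_apply hS _ (map_maxGen f hf hx)]
  | h2 x y hx hy => simp [hx, hy]

theorem aeval_stable {T : Module.End k M} {p : Submodule k M} (hp : ∀ x ∈ p, T x ∈ p)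
    (q : Polynomial k) : ∀ x ∈ p, Polynomial.aeval T q x ∈ p := by
  induction q using Polynomial.induction_on' with
  | add q r hq hr => intro x hx; simpa using p.add_mem (hq x hx) (hr x hx)
  | monomial n a =>
    intro x hx
    rw [Polynomial.aeval_monomial]
    simp only [Module.End.mul_apply, Module.algebraMap_end_apply]
    refine p.smul_mem _ ?_
    clear a
    induction n with
    | zero => simpa
    | succ n ih => rw [pow_succ']; exact hp _ ih

theorem mem_maxGen_aeval {T : Module.End k M} {μ : k} {x : M} :
    x ∈ T.maxGenEigenspace μ ↔ ∃ n : ℕ,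
      Polynomial.aeval T ((Polynomial.X - Polynomial.C μ) ^ n) x = 0 := by
  rw [Module.End.mem_maxGenEigenspace]
  simp [Algebra.algebraMap_eq_smul_one]

/-- An invariant subspace is the sum of its intersections with generalized eigenspaces. -/
theorem le_iSup_inf {T : Module.End k M} (h : Spans T) {p : Submodule k M}
    (hp : ∀ x ∈ p, T x ∈ p) : p ≤ ⨆ μ : k, p ⊓ T.maxGenEigenspace μ := by
  classical
  intro x hx
  have hx' : x ∈ ⨆ μ : k, T.maxGenEigenspace μ := by rw [show _ = _ from h]; trivial
  obtain ⟨m, hm, rfl⟩ := (Submodule.mem_iSup_iff_exists_finsupp _ _).mp hx'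
  refine (Submodule.mem_iSup_iff_exists_finsupp _ _).mpr ⟨m, fun μ => ⟨?_, hm μ⟩, rfl⟩
  choose l hl using fun μ => mem_maxGen_aeval.mp (hm μ)
  by_cases hμ : μ ∈ m.support
  swap
  · rw [Finsupp.notMem_support_iff.mp hμ]; exact p.zero_mem
  let R : Polynomial k := ∏ ν ∈ m.support.erase μ, (Polynomial.X - Polynomial.C ν) ^ l ν
  have hcop : IsCoprime ((Polynomial.X - Polynomial.C μ) ^ l μ) R := by
    refine IsCoprime.prod_right fun ν hν => IsCoprime.pow ?_
    exact Polynomial.isCoprime_X_sub_C_of_isUnit_sub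
      (IsUnit.mk0 _ (sub_ne_zero.mpr (Finset.ne_of_mem_erase hν).symm))
  obtain ⟨u, v, huv⟩ := hcop
  have hR : ∀ ν ∈ m.support, ν ≠ μ → Polynomial.aeval T R (m ν) = 0 := by
    intro ν hν hne
    obtain ⟨w, hw⟩ : (Polynomial.X - Polynomial.C ν) ^ l ν ∣ R :=
      Finset.dvd_prod_of_mem _ (Finset.mem_erase.mpr ⟨hne, hν⟩)
    rw [hw, mul_comm, map_mul, Module.End.mul_apply, hl, map_zero]
  have key : Polynomial.aeval T (v * R) (m.sum fun _ y => y) = m μ := by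
    rw [Finsupp.sum, map_sum, Finset.sum_eq_single μ]
    · have h1 : Polynomial.aeval T (u * (Polynomial.X - Polynomial.C μ) ^ l μ + v * R) (m μ)
          = m μ := by rw [huv]; simp
      rw [map_add, LinearMap.add_apply, map_mul, Module.End.mul_apply, hl, map_zero, zero_add] at h1
      exact h1
    · intro ν hν hne
      rw [map_mul, Module.End.mul_apply, hR ν hν hne, map_zero]
    · intro h; exact absurd hμ h
  rw [← key]
  exact aeval_stable hp _ _ hx

theorem inv_induction {T : Module.End k M} (h : Spans T) {p : Submodule k M}
    (hp : ∀ x ∈ p, T x ∈ p) {P : M → Prop}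
    (h1 : ∀ μ, ∀ x ∈ T.maxGenEigenspace μ, x ∈ p → P x) (h2 : ∀ x y, P x → P y → P (x + y))
    (x : M) (hx : x ∈ p) : P x := by
  refine Submodule.iSup_induction _ (motive := P) (le_iSup_inf h hp hx)
    (fun μ x hx => h1 μ x hx.2 hx.1) (h1 0 0 (Submodule.zero_mem _) p.zero_mem) h2

theorem op_stable {T : Module.End k M} (h : Spans T) {p : Submodule k M}
    (hp : ∀ x ∈ p, T x ∈ p) (c : k → k) (x : M) (hx : x ∈ p) : op T c x ∈ p := by
  refine inv_induction h hp (P := fun x => op T c x ∈ p) ?_ ?_ x hx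
  · intro μ x hx hxp
    rw [op_apply h c hx]; exact p.smul_mem _ hxp
  · intro x y hx hy; rw [map_add]; exact p.add_mem hx hy

/-- if `q(T) F ∈ J` and `F` is in a generalized eigenspace for a non-root, `F ∈ J` -/
theorem mem_of_not_root {T : Module.End k M} {p : Submodule k M}
    (hp : ∀ x ∈ p, T x ∈ p) {q : Polynomial k} {μ : k} (hμ : q.eval μ ≠ 0) {x : M}
    (hx : x ∈ T.maxGenEigenspace μ) (hq : Polynomial.aeval T q x ∈ p) : x ∈ p := by
  obtain ⟨l, hl⟩ := mem_maxGen_aeval.mp hx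
  have hcop : IsCoprime ((Polynomial.X - Polynomial.C μ) ^ l) q := by
    refine IsCoprime.pow_left ?_
    refine ((Polynomial.irreducible_X_sub_C μ).coprime_iff_not_dvd).mpr ?_
    rw [Polynomial.dvd_iff_isRoot]
    exact hμ
  obtain ⟨u, v, huv⟩ := hcop
  have h1 : Polynomial.aeval T (u * (Polynomial.X - Polynomial.C μ) ^ l + v * q) x = x := by
    rw [huv]; simp
  rw [map_add, LinearMap.add_apply, map_mul, Module.End.mul_apply, hl, map_zero, zero_add,
    map_mul, Module.End.mul_apply] at h1
  rw [← h1]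
  exact aeval_stable hp _ _ hq

end opsec

section dersec
variable {k : Type} [Field k] {A : Type*} [CommRing A] [Algebra k A] (D : Derivation k A A)

theorem maxGen_mul {a b : k} {x y : A}
    (hx : x ∈ Module.End.maxGenEigenspace (D : A →ₗ[k] A) a)
    (hy : y ∈ Module.End.maxGenEigenspace (D : A →ₗ[k] A) b) :
    x * y ∈ Module.End.maxGenEigenspace (D : A →ₗ[k] A) (a + b) := by
  rw [Module.End.mem_maxGenEigenspace] at *
  obtain ⟨p, hp⟩ := hx
  obtain ⟨q, hq⟩ := hy
  refine ⟨p + q, ?_⟩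
  generalize hN : p + q = N
  induction N generalizing p q x y with
  | zero =>
    obtain rfl : p = 0 := by omega
    simp at hp; simp [hp]
  | succ N ih =>
    rcases p with _ | p
    · simp at hp; simp [hp]
    rcases q with _ | q
    · simp at hq; simp [hq]
    have e : ((D : A →ₗ[k] A) - (a + b) • (1 : Module.End k A)) (x * y) =
        (((D : A →ₗ[k] A) - a • (1 : Module.End k A)) x) * y +
        x * (((D : A →ₗ[k] A) - b • (1 : Module.End k A)) y) := by
      simp [Algebra.smul_def]; ring
    rw [pow_succ, Module.End.mul_apply, e, map_add]
    rw [ih p (by rw [pow_succ, Module.End.mul_apply] at hp; exact hp) (q + 1) hq (by omega),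
      ih (p + 1) hp q (by rw [pow_succ, Module.End.mul_apply] at hq; exact hq) (by omega), add_zero]

theorem maxGen_one : (1 : A) ∈ Module.End.maxGenEigenspace (D : A →ₗ[k] A) 0 := by
  rw [Module.End.mem_maxGenEigenspace]
  exact ⟨1, by simp⟩

/-- Weights in a subgroup span. -/
def SpansIn {M : Type*} [AddCommGroup M] [Module k M] (T : Module.End k M) (L : AddSubgroup k) :
    Prop := ⨆ μ : L, T.maxGenEigenspace (μ : k) = ⊤

theorem SpansIn.spans {M : Type*} [AddCommGroup M] [Module k M] {T : Module.End k M}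
    {L : AddSubgroup k} (h : SpansIn T L) : Spans T := by
  rw [Spans, eq_top_iff, ← show _ = _ from h]
  exact iSup_le fun μ => le_iSup (fun μ : k => T.maxGenEigenspace μ) (μ : k)

theorem spansIn_induction {M : Type*} [AddCommGroup M] [Module k M] {T : Module.End k M}
    {L : AddSubgroup k} (h : SpansIn T L) {P : M → Prop}
    (h1 : ∀ μ ∈ L, ∀ x ∈ T.maxGenEigenspace μ, P x) (h2 : ∀ x y, P x → P y → P (x + y)) (x : M) :
    P x := by
  have hx : x ∈ ⨆ μ : L, T.maxGenEigenspace (μ : k) := by rw [show _ = _ from h]; trivial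
  exact Submodule.iSup_induction _ (motive := P) hx (fun μ => h1 μ μ.2)
    (h1 0 L.zero_mem 0 (Submodule.zero_mem _)) h2

variable {D}
theorem op_mul_apply {L : AddSubgroup k} (h : SpansIn (D : A →ₗ[k] A) L) (c : k → k)
    (hc : ∀ a ∈ L, ∀ b ∈ L, c (a + b) = c a * c b) (x y : A) :
    op (D : A →ₗ[k] A) c (x * y) = op (D : A →ₗ[k] A) c x * op (D : A →ₗ[k] A) c y := by
  induction x using spansIn_induction h with
  | h2 x x' hx hx' => simp [add_mul, hx, hx']
  | h1 a ha x hx =>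
  induction y using spansIn_induction h with
  | h2 x x' hx hx' => simp [mul_add, hx, hx']
  | h1 b hb y hy =>
    rw [op_apply h.spans c hx, op_apply h.spans c hy, op_apply h.spans c (maxGen_mul D hx hy),
      hc a ha b hb]
    simp [Algebra.smul_def]; ring

theorem op_leibniz {L : AddSubgroup k} (h : SpansIn (D : A →ₗ[k] A) L) (c : k → k)
    (hc : ∀ a ∈ L, ∀ b ∈ L, c (a + b) = c a + c b) (x y : A) :
    op (D : A →ₗ[k] A) c (x * y) = x * op (D : A →ₗ[k] A) c y + y * op (D : A →ₗ[k] A) c x := by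
  induction x using spansIn_induction h with
  | h2 x x' hx hx' => simp [add_mul, mul_add, hx, hx']; ring
  | h1 a ha x hx =>
  induction y using spansIn_induction h with
  | h2 x x' hx hx' => simp [mul_add, add_mul, hx, hx']; ring
  | h1 b hb y hy =>
    rw [op_apply h.spans c hx, op_apply h.spans c hy, op_apply h.spans c (maxGen_mul D hx hy),
      hc a ha b hb]
    simp [Algebra.smul_def]; ring

end dersec


section lie
variable {k : Type} [Field k] {n : ℕ}

/-- Polynomial ring in the matrix entries and the inverse determinant. -/
abbrev PR (n : ℕ) (k : Type) [Field k] := MvPolynomial ((Fin n × Fin n) ⊕ Unit) k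

/-- The point of affine space attached to an invertible matrix. -/
def gpt (g : GL (Fin n) k) : (Fin n × Fin n) ⊕ Unit → k :=
  Sum.elim (mat2pt (g : Matrix (Fin n) (Fin n) k))
    (fun _ => ((g⁻¹ : GL (Fin n) k) : Matrix (Fin n) (Fin n) k).det)

/-- Evaluation at an invertible matrix. -/
noncomputable def ev (g : GL (Fin n) k) : PR n k →ₐ[k] k := MvPolynomial.aeval (gpt g)

@[simp] theorem ev_inl (g : GL (Fin n) k) (i j : Fin n) :
    ev g (MvPolynomial.X (Sum.inl (i, j))) = (g : Matrix (Fin n) (Fin n) k) i j := by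
  simp [ev, gpt, mat2pt]

@[simp] theorem ev_inr (g : GL (Fin n) k) (u : Unit) :
    ev g (MvPolynomial.X (Sum.inr u)) = ((g⁻¹ : GL (Fin n) k) : Matrix (Fin n) (Fin n) k).det := by
  simp [ev, gpt]

@[simp] theorem ev_C (g : GL (Fin n) k) (a : k) : ev g (MvPolynomial.C a) = a := by
  simp [ev]

theorem der_ext {B : Type*} [CommRing B] [Algebra k B] (φ : PR n k →ₐ[k] B)
    (l₁ l₂ : PR n k →ₗ[k] B)
    (h₁ : ∀ f g, l₁ (f * g) = φ f * l₁ g + φ g * l₁ f)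
    (h₂ : ∀ f g, l₂ (f * g) = φ f * l₂ g + φ g * l₂ f)
    (hX : ∀ i, l₁ (MvPolynomial.X i) = l₂ (MvPolynomial.X i)) : l₁ = l₂ := by
  have one : ∀ l : PR n k →ₗ[k] B, (∀ f g, l (f * g) = φ f * l g + φ g * l f) → l 1 = 0 := by
    intro l h
    have := h 1 1
    simpa using this
  refine LinearMap.ext fun f => ?_
  induction f using MvPolynomial.induction_on with
  | C a =>
    have : (MvPolynomial.C a : PR n k) = a • 1 := by
      rw [MvPolynomial.smul_eq_C_mul, mul_one]
    rw [this, map_smul, map_smul, one l₁ h₁, one l₂ h₂]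
  | add p q hp hq => rw [map_add, map_add, hp, hq]
  | mul_X p i hp => rw [h₁, h₂, hp, hX]

/-- The left invariant vector field attached to a matrix. -/
noncomputable def DD (a : Matrix (Fin n) (Fin n) k) : Derivation k (PR n k) (PR n k) :=
  MvPolynomial.mkDerivation k (Sum.elim
    (fun ij => ∑ l, MvPolynomial.C (a l ij.2) * MvPolynomial.X (Sum.inl (ij.1, l)))
    (fun _ => MvPolynomial.C (-a.trace) * MvPolynomial.X (Sum.inr ())))

@[simp] theorem DD_inl (a : Matrix (Fin n) (Fin n) k) (i j : Fin n) :
    DD a (MvPolynomial.X (Sum.inl (i, j))) =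
      ∑ l, MvPolynomial.C (a l j) * MvPolynomial.X (Sum.inl (i, l)) := by
  simp [DD, MvPolynomial.mkDerivation_X]

@[simp] theorem DD_inr (a : Matrix (Fin n) (Fin n) k) (u : Unit) :
    DD a (MvPolynomial.X (Sum.inr u)) =
      MvPolynomial.C (-a.trace) * MvPolynomial.X (Sum.inr ()) := by
  simp [DD, MvPolynomial.mkDerivation_X]

theorem DD_C_mul (a : Matrix (Fin n) (Fin n) k) (c : k) (f : PR n k) :
    DD a (MvPolynomial.C c * f) = MvPolynomial.C c * DD a f := by
  rw [← MvPolynomial.smul_eq_C_mul, Derivation.map_smul, MvPolynomial.smul_eq_C_mul]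

theorem DD_add (a b : Matrix (Fin n) (Fin n) k) : DD (a + b) = DD a + DD b := by
  ext1 i
  rcases i with ⟨i, j⟩ | u
  · simp [add_mul, Finset.sum_add_distrib]
  · simp; ring

theorem DD_smul (c : k) (b : Matrix (Fin n) (Fin n) k) : DD (c • b) = c • DD b := by
  ext1 i
  rcases i with ⟨i, j⟩ | u
  · simp [Finset.smul_sum, MvPolynomial.smul_eq_C_mul, mul_assoc]
  · simp [MvPolynomial.smul_eq_C_mul, mul_assoc]

theorem DD_zero : DD (0 : Matrix (Fin n) (Fin n) k) = 0 := by
  have := DD_smul (0 : k) (0 : Matrix (Fin n) (Fin n) k)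
  simpa using this

theorem DD_lie (a b : Matrix (Fin n) (Fin n) k) : DD (a * b - b * a) = ⁅DD a, DD b⁆ := by
  ext1 i
  rw [Derivation.commutator_apply]
  rcases i with ⟨i, j⟩ | u
  · simp only [DD_inl, map_sum, DD_C_mul, Ring.lie_def, Matrix.sub_apply, Matrix.mul_apply,
      MvPolynomial.C_sub, sub_mul, Finset.sum_sub_distrib, Finset.sum_mul, MvPolynomial.C_mul,
      Finset.mul_sum]
    congr 1
    · rw [Finset.sum_comm]
      refine Finset.sum_congr rfl fun _ _ => Finset.sum_congr rfl fun _ _ => by ring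
    · rw [Finset.sum_comm]
      refine Finset.sum_congr rfl fun _ _ => Finset.sum_congr rfl fun _ _ => by ring
  · have : (a * b - b * a).trace = 0 := by
      rw [Matrix.trace_sub, Matrix.trace_mul_comm, sub_self]
    simp only [DD_inr, DD_C_mul, this]
    simp; ring

theorem DD_lie_apply (a b : Matrix (Fin n) (Fin n) k) (f : PR n k) :
    DD (a * b - b * a) f = DD a (DD b f) - DD b (DD a f) := by
  rw [DD_lie, Derivation.commutator_apply]

/-- Left translation. -/
noncomputable def LT (g : GL (Fin n) k) : PR n k →ₐ[k] PR n k :=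
  MvPolynomial.aeval (Sum.elim
    (fun ij => ∑ l, MvPolynomial.C ((g : Matrix (Fin n) (Fin n) k) ij.1 l) *
      MvPolynomial.X (Sum.inl (l, ij.2)))
    (fun _ => MvPolynomial.C (((g⁻¹ : GL (Fin n) k) : Matrix (Fin n) (Fin n) k).det) *
      MvPolynomial.X (Sum.inr ())))

theorem ev_LT (g u : GL (Fin n) k) (f : PR n k) : ev u (LT g f) = ev (g * u) f := by
  have : (ev u).comp (LT g) = ev (g * u) := by
    ext i
    rcases i with ⟨i, j⟩ | v
    · simp [LT, Matrix.mul_apply]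
    · simp only [LT, AlgHom.comp_apply, MvPolynomial.aeval_X, Sum.elim_inr, map_mul, ev_C, ev_inr,
        mul_inv_rev, Units.val_mul, Matrix.det_mul]
      ring
  rw [← this]; rfl

theorem DD_LT (a : Matrix (Fin n) (Fin n) k) (g : GL (Fin n) k) (f : PR n k) :
    DD a (LT g f) = LT g (DD a f) := by
  have : (DD a : PR n k →ₗ[k] PR n k) ∘ₗ (LT g).toLinearMap =
      (LT g).toLinearMap ∘ₗ (DD a : PR n k →ₗ[k] PR n k) := by
    refine der_ext (LT g) _ _ ?_ ?_ ?_
    · intro f h; simp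
    · intro f h; simp
    · rintro (⟨i, j⟩ | v)
      · simp only [LT, LinearMap.comp_apply, AlgHom.toLinearMap_apply, MvPolynomial.aeval_X,
          Sum.elim_inl, Derivation.coeFn_coe, map_sum, DD_C_mul, DD_inl, map_mul, Finset.mul_sum,
          MvPolynomial.aeval_C, MvPolynomial.algebraMap_eq]
        rw [Finset.sum_comm]
        refine Finset.sum_congr rfl fun _ _ => Finset.sum_congr rfl fun _ _ => by ring
      · simp only [LT, LinearMap.comp_apply, AlgHom.toLinearMap_apply, MvPolynomial.aeval_X,
          Sum.elim_inr, Derivation.coeFn_coe, DD_C_mul, DD_inr, map_mul,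
          MvPolynomial.aeval_C, MvPolynomial.algebraMap_eq]
        ring
  exact LinearMap.congr_fun this f

/-- The ideal of polynomials vanishing on `H`. -/
def JJ (H : Subgroup (GL (Fin n) k)) : Ideal (PR n k) where
  carrier := {f | ∀ h ∈ H, ev h f = 0}
  add_mem' := by intro a b ha hb h hh; rw [map_add, ha h hh, hb h hh, add_zero]
  zero_mem' := by intro h _; exact map_zero _
  smul_mem' := by intro c a ha h hh; rw [smul_eq_mul, map_mul, ha h hh, mul_zero]

theorem mem_JJ {H : Subgroup (GL (Fin n) k)} {f : PR n k} : f ∈ JJ H ↔ ∀ h ∈ H, ev h f = 0 :=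
  Iff.rfl

/-- Zariski closed subgroups. -/
def Cl (H : Subgroup (GL (Fin n) k)) : Prop := ∀ g, (∀ f ∈ JJ H, ev g f = 0) → g ∈ H

theorem LT_mem {H : Subgroup (GL (Fin n) k)} {f : PR n k} (hf : f ∈ JJ H) {h : GL (Fin n) k}
    (hh : h ∈ H) : LT h f ∈ JJ H := by
  intro u hu
  rw [ev_LT]; exact hf _ (H.mul_mem hh hu)

/-- The Lie algebra of `H`. -/
noncomputable def LieH (H : Subgroup (GL (Fin n) k)) : Submodule k (Matrix (Fin n) (Fin n) k) where
  carrier := {a | ∀ f ∈ JJ H, DD a f ∈ JJ H}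
  add_mem' := by
    intro a b ha hb f hf
    rw [DD_add]; exact (JJ H).add_mem (ha f hf) (hb f hf)
  zero_mem' := by
    intro f _; rw [DD_zero]; exact (JJ H).zero_mem
  smul_mem' := by
    intro c a ha f hf
    rw [DD_smul, Derivation.smul_apply, MvPolynomial.smul_eq_C_mul]
    exact (JJ H).mul_mem_left _ (ha f hf)

theorem mem_LieH {H : Subgroup (GL (Fin n) k)} {a : Matrix (Fin n) (Fin n) k} :
    a ∈ LieH H ↔ ∀ f ∈ JJ H, DD a f ∈ JJ H := Iff.rfl

theorem LieH_lie {H : Subgroup (GL (Fin n) k)} {a b : Matrix (Fin n) (Fin n) k}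
    (ha : a ∈ LieH H) (hb : b ∈ LieH H) : a * b - b * a ∈ LieH H := by
  intro f hf
  rw [DD_lie_apply]
  exact (JJ H).sub_mem (ha _ (hb f hf)) (hb _ (ha f hf))

theorem mem_LieH' {H : Subgroup (GL (Fin n) k)} {a : Matrix (Fin n) (Fin n) k} :
    a ∈ LieH H ↔ ∀ f ∈ JJ H, ev 1 (DD a f) = 0 := by
  refine ⟨fun h f hf => h f hf 1 H.one_mem, fun h f hf u hu => ?_⟩
  have := h _ (LT_mem hf hu)
  rwa [DD_LT, ev_LT, mul_one] at this

theorem LieH_mono {H K : Subgroup (GL (Fin n) k)} (h : H ≤ K) {a : Matrix (Fin n) (Fin n) k}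
    (ha : a ∈ LieH H) : a ∈ LieH K := by
  rw [mem_LieH'] at *
  intro f hf
  exact ha f fun u hu => hf u (h hu)

/-- The determinant polynomial. -/
noncomputable def detP (n : ℕ) (k : Type) [Field k] : PR n k :=
  (Matrix.of fun i j : Fin n => (MvPolynomial.X (Sum.inl (i, j)) : PR n k)).det

theorem ev_detP (g : GL (Fin n) k) : ev g (detP n k) = (g : Matrix (Fin n) (Fin n) k).det := by
  rw [detP, AlgHom.map_det]
  congr 1
  ext i j
  simp

theorem detP_mem (H : Subgroup (GL (Fin n) k)) :
    detP n k * MvPolynomial.X (Sum.inr ()) - 1 ∈ JJ H := by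
  intro h _
  rw [map_sub, map_mul, ev_detP, ev_inr, map_one, ← Matrix.det_mul, ← Units.val_mul]
  simp

theorem det_dual (l : PR n k →ₗ[k] k) (hl : ∀ f g, l (f * g) = ev 1 f * l g + ev 1 g * l f) :
    l (detP n k) = (Matrix.of fun i j => l (MvPolynomial.X (Sum.inl (i, j)))).trace := by
  have one : l 1 = 0 := by simpa using hl 1 1
  let φ : PR n k →+* DualNumber k :=
    { toFun := fun f => TrivSqZeroExt.inl (ev 1 f) + TrivSqZeroExt.inr (l f)
      map_one' := by ext <;> simp [one]
      map_zero' := by ext <;> simp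
      map_add' := by intro f g; ext <;> simp
      map_mul' := by intro f g; ext <;> simp [hl, mul_comm] }
  have h1 : φ (detP n k) =
      (1 + (DualNumber.eps : DualNumber k) •
        (Matrix.of fun i j => l (MvPolynomial.X (Sum.inl (i, j)))).map
          (TrivSqZeroExt.inlHom k k)).det := by
    rw [detP, RingHom.map_det]
    congr 1
    ext i j
    · by_cases h : i = j <;> simp [φ, Matrix.one_apply, h]
    · by_cases h : i = j <;> simp [φ, Matrix.one_apply, h]
  rw [Matrix.det_one_add_smul] at h1
  have h2 := congrArg TrivSqZeroExt.snd h1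
  have h3 : (∑ i, (TrivSqZeroExt.inl (l (MvPolynomial.X (Sum.inl (i, i)))) : DualNumber k)).fst
      = ∑ i, l (MvPolynomial.X (Sum.inl (i, i))) := by
    rw [← TrivSqZeroExt.fstHom_apply (S := k) k k, map_sum]; simp
  simpa [φ, Matrix.trace, pow_two, h3] using h2

/-- Point derivations at `1` come from matrices. -/
theorem point_der {H : Subgroup (GL (Fin n) k)} (l : PR n k →ₗ[k] k)
    (hl : ∀ f g, l (f * g) = ev 1 f * l g + ev 1 g * l f) (hJ : ∀ f ∈ JJ H, l f = 0)
    (a : Matrix (Fin n) (Fin n) k) (ha : ∀ i j, l (MvPolynomial.X (Sum.inl (i, j))) = a i j) :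
    a ∈ LieH H ∧ ∀ f, l f = ev 1 (DD a f) := by
  have one : l 1 = 0 := by simpa using hl 1 1
  have hd : l (MvPolynomial.X (Sum.inr ())) = - a.trace := by
    have h1 := hJ _ (detP_mem H)
    rw [map_sub, one, sub_zero, hl, ev_detP, det_dual l hl] at h1
    have h2 : (Matrix.of fun i j => l (MvPolynomial.X (Sum.inl (i, j)))) = a := by
      ext i j; exact ha i j
    rw [h2] at h1
    simp at h1
    linear_combination h1
  have key : l = (ev 1).toLinearMap ∘ₗ (DD a : PR n k →ₗ[k] PR n k) := by
    refine der_ext (ev 1) _ _ hl ?_ ?_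
    · intro f g; simp
    · rintro (⟨i, j⟩ | v)
      · rw [ha]; simp [Matrix.one_apply]
      · simp [hd]
  have key' : ∀ f, l f = ev 1 (DD a f) := fun f => by rw [key]; rfl
  refine ⟨mem_LieH'.mpr fun f hf => ?_, key'⟩
  rw [← key', hJ f hf]

/-- Conjugation. -/
noncomputable def CT (g : GL (Fin n) k) : PR n k →ₐ[k] PR n k :=
  MvPolynomial.aeval (Sum.elim
    (fun ij => ∑ m, ∑ l, MvPolynomial.C ((g : Matrix (Fin n) (Fin n) k) ij.1 l *
        ((g⁻¹ : GL (Fin n) k) : Matrix (Fin n) (Fin n) k) m ij.2) *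
      MvPolynomial.X (Sum.inl (l, m)))
    (fun _ => MvPolynomial.X (Sum.inr ())))

theorem ev_CT (g u : GL (Fin n) k) (f : PR n k) : ev u (CT g f) = ev (g * u * g⁻¹) f := by
  have : (ev u).comp (CT g) = ev (g * u * g⁻¹) := by
    ext i
    rcases i with ⟨i, j⟩ | v
    · simp only [CT, AlgHom.comp_apply, MvPolynomial.aeval_X, Sum.elim_inl, map_sum, map_mul, ev_C,
        ev_inl, Units.val_mul, Matrix.mul_apply, Finset.sum_mul]
      refine Finset.sum_congr rfl fun _ _ => Finset.sum_congr rfl fun _ _ => by ring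
    · have h1 : (g * u * g⁻¹)⁻¹ = g * u⁻¹ * g⁻¹ := by group
      have h2 : (g : Matrix (Fin n) (Fin n) k).det *
          ((g⁻¹ : GL (Fin n) k) : Matrix (Fin n) (Fin n) k).det = 1 := by
        rw [← Matrix.det_mul, ← Units.val_mul]; simp
      simp only [CT, AlgHom.comp_apply, MvPolynomial.aeval_X, Sum.elim_inr, ev_inr, h1,
        Units.val_mul, Matrix.det_mul]
      linear_combination (-((u⁻¹ : GL (Fin n) k) : Matrix (Fin n) (Fin n) k).det) * h2
  rw [← this]; rfl

theorem Ad_mem {H : Subgroup (GL (Fin n) k)} {g : GL (Fin n) k} (hg : g ∈ H)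
    {a : Matrix (Fin n) (Fin n) k} (ha : a ∈ LieH H) :
    (g : Matrix (Fin n) (Fin n) k) * a * ((g⁻¹ : GL (Fin n) k) : Matrix (Fin n) (Fin n) k) ∈ LieH H := by
  have e1 : ∀ f, ev 1 (CT g f) = ev 1 f := by intro f; rw [ev_CT]; simp
  refine (point_der (H := H) ((ev 1).toLinearMap ∘ₗ (DD a : PR n k →ₗ[k] PR n k) ∘ₗ
    (CT g).toLinearMap) ?_ ?_ _ ?_).1
  · intro f h
    simp [e1]
  · intro f hf
    simp only [LinearMap.comp_apply, AlgHom.toLinearMap_apply, Derivation.coeFn_coe]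
    refine mem_LieH'.mp ha _ fun u hu => ?_
    rw [ev_CT]
    exact hf _ (H.mul_mem (H.mul_mem hg hu) (H.inv_mem hg))
  · intro i j
    simp only [CT, LinearMap.comp_apply, AlgHom.toLinearMap_apply, Derivation.coeFn_coe,
      MvPolynomial.aeval_X, Sum.elim_inl, map_sum, DD_C_mul, DD_inl, map_mul, ev_C, ev_inl,
      Units.val_one, Matrix.one_apply, Matrix.mul_apply, Finset.sum_mul]
    refine Finset.sum_congr rfl fun _ _ => Finset.sum_congr rfl fun _ _ => ?_
    simp [Matrix.one_apply]
    ring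

end lie


section stepN
variable {k : Type} [Field k] {n : ℕ}

theorem finite_of_delta {H : Subgroup (GL (Fin n) k)} (r : PR n k) (h1 : ev 1 r = 1)
    (h2 : ∀ h ∈ H, h ≠ 1 → ev h r = 0) : (H : Set (GL (Fin n) k)).Finite := by
  classical
  have hfg : (Ideal.span ((fun h => LT h⁻¹ r) '' (H : Set (GL (Fin n) k)))).FG :=
    IsNoetherian.noetherian _
  obtain ⟨S, hS, hS'⟩ := Submodule.fg_span_iff_fg_span_finset_subset _ |>.mp hfg
  obtain ⟨T, hT, hTS⟩ := Set.subset_image_iff.mp hS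
  have hfin : ((fun h => LT h⁻¹ r) '' T).Finite := by rw [hTS]; exact S.finite_toSet
  have hinj : Set.InjOn (fun h => LT h⁻¹ r) (H : Set (GL (Fin n) k)) := by
    intro u hu v hv huv
    by_contra hne
    have h3 := congrArg (ev u) huv
    simp only [ev_LT, inv_mul_cancel] at h3
    rw [h1, h2 _ (H.mul_mem (H.inv_mem hv) hu)] at h3
    · exact one_ne_zero h3
    · intro h; exact hne (inv_mul_eq_one.mp h).symm
  have hTfin : T.Finite := Set.Finite.of_finite_image hfin (hinj.mono hT)
  refine hTfin.subset fun h hh => ?_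
  by_contra hne
  have hm : LT h⁻¹ r ∈ Ideal.span ((fun h => LT h⁻¹ r) '' (H : Set (GL (Fin n) k))) :=
    Ideal.subset_span ⟨h, hh, rfl⟩
  have hS2 : Ideal.span ((fun h => LT h⁻¹ r) '' (H : Set (GL (Fin n) k))) =
    Ideal.span (S : Set (PR n k)) := hS'
  rw [hS2, ← hTS] at hm
  have hle : Ideal.span ((fun h => LT h⁻¹ r) '' T) ≤ RingHom.ker (ev h) := by
    rw [Ideal.span_le]
    rintro _ ⟨u, hu, rfl⟩
    simp only [SetLike.mem_coe, RingHom.mem_ker, ev_LT]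
    refine h2 _ (H.mul_mem (H.inv_mem (hT hu)) hh) fun h3 => ?_
    rw [inv_mul_eq_one] at h3
    exact hne (h3 ▸ hu)
  have := hle hm
  rw [RingHom.mem_ker, ev_LT, inv_mul_cancel, h1] at this
  exact one_ne_zero this

theorem exists_lie_ne_zero {H : Subgroup (GL (Fin n) k)} (hinf : (H : Set (GL (Fin n) k)).Infinite) :
    ∃ a ∈ LieH H, a ≠ 0 := by
  by_contra! hcon
  apply hinf
  set M : Ideal (PR n k) := RingHom.ker (ev (1 : GL (Fin n) k)) with hM
  have hMm : ∀ f, f ∈ M ↔ ev 1 f = 0 := fun f => RingHom.mem_ker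
  have hJM : JJ H ≤ M := fun f hf => hf 1 H.one_mem
  have hle : M ≤ JJ H ⊔ M • M := by
    intro f hf
    by_contra hfn
    let p : Submodule k (PR n k) := (JJ H ⊔ M • M).restrictScalars k ⊔ Submodule.span k {1}
    have hfp : f ∉ p := by
      intro h
      obtain ⟨s, hs, t, ht, rfl⟩ := Submodule.mem_sup.mp h
      obtain ⟨c, rfl⟩ := Submodule.mem_span_singleton.mp ht
      have hs' : s ∈ M := (sup_le hJM (Ideal.mul_le_left)) hs
      rw [hMm, map_add, (hMm s).mp hs', zero_add, map_smul, map_one, smul_eq_mul, mul_one] at hf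
      rw [hf, zero_smul, add_zero] at hfn
      exact hfn hs
    obtain ⟨l, hl1, hl2⟩ := Submodule.exists_le_ker_of_notMem hfp
    have one : l 1 = 0 := hl2 (Submodule.mem_sup_right (Submodule.mem_span_singleton_self _))
    have hJ : ∀ f ∈ JJ H, l f = 0 := fun f hf =>
      hl2 (Submodule.mem_sup_left (Submodule.mem_sup_left hf))
    have hder : ∀ f g, l (f * g) = ev 1 f * l g + ev 1 g * l f := by
      intro f g
      have : l ((f - MvPolynomial.C (ev 1 f)) * (g - MvPolynomial.C (ev 1 g))) = 0 := by
        refine hl2 (Submodule.mem_sup_left (Submodule.mem_sup_right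
          (Submodule.smul_mem_smul ?_ ?_))) <;> simp [hMm]
      have e : (f - MvPolynomial.C (ev 1 f)) * (g - MvPolynomial.C (ev 1 g)) =
          f * g - (ev 1 f) • g - (ev 1 g) • f + (ev 1 f * ev 1 g) • 1 := by
        simp only [MvPolynomial.smul_eq_C_mul, map_mul]; ring
      rw [e] at this
      simp only [map_add, map_sub, map_smul, one, smul_eq_mul] at this
      linear_combination this
    obtain ⟨ha, hb⟩ := point_der (H := H) l hder hJ (Matrix.of fun i j => l (MvPolynomial.X (Sum.inl (i, j))))
      (fun i j => rfl)
    apply hl1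
    rw [hb, hcon _ ha, DD_zero]; simp
  obtain ⟨r, hr1, hr2⟩ := Submodule.exists_sub_one_mem_and_smul_le_of_fg_of_le_sup
    (IsNoetherian.noetherian M) (le_refl M) hle
  refine finite_of_delta r ?_ ?_
  · have := (hMm _).mp hr1
    rw [map_sub, map_one] at this
    linear_combination this
  · intro h hh hne
    have : ∃ i j, (h : Matrix (Fin n) (Fin n) k) i j ≠ (1 : Matrix (Fin n) (Fin n) k) i j := by
      by_contra! hc
      exact hne (Units.ext (Matrix.ext hc))
    obtain ⟨i, j, hij⟩ := this
    set f : PR n k := MvPolynomial.X (Sum.inl (i, j)) - MvPolynomial.C ((1 : Matrix (Fin n) (Fin n) k) i j)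
    have hf : f ∈ M := by rw [hMm]; simp [f]
    have hrf : r * f ∈ JJ H := hr2 (Submodule.smul_mem_pointwise_smul f r M hf)
    have h3 := hrf h hh
    rw [map_mul, mul_eq_zero] at h3
    rcases h3 with h3 | h3
    · exact h3
    · simp [f, sub_eq_zero] at h3; exact absurd h3 hij

end stepN


section stepR
variable {k : Type} [Field k] {n : ℕ}

theorem exists_z [CharZero k] (S : Set k) (hS : S.Finite) (μ : k) (hμ : μ ∈ AddSubgroup.closure S)
    (h0 : μ ≠ 0) : ∃ z : k → ℤ, (∀ a ∈ AddSubgroup.closure S, ∀ b ∈ AddSubgroup.closure S,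
      z (a + b) = z a + z b) ∧ z μ ≠ 0 := by
  classical
  set L := AddSubgroup.closure S
  have : AddGroup.FG L := (AddGroup.fg_iff_addSubgroup_fg L).mpr ⟨hS.toFinset, by simp [L]⟩
  have hf : Module.Finite ℤ L := Module.Finite.iff_addGroup_fg.mpr this
  have hT : Module.IsTorsionFree ℤ L :=
    Function.Injective.moduleIsTorsionFree (f := fun x : L => (x : k)) Subtype.val_injective
      (fun c x => by simp)
  have hfree : Module.Free ℤ L := inferInstance
  obtain ⟨f, hf⟩ := Module.Projective.exists_dual_ne_zero ℤ (x := (⟨μ, hμ⟩ : L))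
    (fun h => h0 (congrArg Subtype.val h))
  refine ⟨fun a => if h : a ∈ L then f ⟨a, h⟩ else 0, ?_, ?_⟩
  · intro a ha b hb
    simp only [dif_pos ha, dif_pos hb, dif_pos (L.add_mem ha hb), ← map_add]
    rfl
  · simpa only [dif_pos hμ] using hf

/-- The endomorphism attached to a matrix. -/
noncomputable abbrev TL (a : Matrix (Fin n) (Fin n) k) : Module.End k (Fin n → k) :=
  Matrix.toLin' a

/-- The linear forms of a row. -/
noncomputable def rowF (i : Fin n) : (Fin n → k) →ₗ[k] PR n k where
  toFun w := ∑ l, w l • MvPolynomial.X (Sum.inl (i, l))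
  map_add' := by intro v w; simp [add_smul, Finset.sum_add_distrib]
  map_smul' := by intro c w; simp [mul_smul, Finset.smul_sum]

theorem rowF_apply (i : Fin n) (w : Fin n → k) :
    rowF i w = ∑ l, w l • (MvPolynomial.X (Sum.inl (i, l)) : PR n k) := rfl

theorem rowF_single (i j : Fin n) :
    rowF i (Pi.single j (1 : k)) = MvPolynomial.X (Sum.inl (i, j)) := by
  rw [rowF_apply, Finset.sum_eq_single j]
  · simp
  · intro b _ hb; simp [Pi.single_eq_of_ne hb]
  · simp

theorem ev_one_rowF (i : Fin n) (w : Fin n → k) : ev 1 (rowF i w) = w i := by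
  rw [rowF_apply, map_sum, Finset.sum_eq_single i]
  · simp
  · intro b _ hb; simp [Matrix.one_apply_ne hb.symm]
  · simp

theorem DD_rowF (a : Matrix (Fin n) (Fin n) k) (i : Fin n) (w : Fin n → k) :
    rowF i (TL a w) = (DD a : PR n k →ₗ[k] PR n k) (rowF i w) := by
  simp only [rowF_apply, Derivation.coeFn_coe, map_sum, map_smul, Derivation.map_smul, DD_inl,
    Matrix.toLin'_apply, Matrix.mulVec, dotProduct, Finset.sum_smul, Finset.smul_sum,
    MvPolynomial.smul_eq_C_mul, map_mul, DD_C_mul, Finset.mul_sum]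
  rw [Finset.sum_comm]
  refine Finset.sum_congr rfl fun _ _ => Finset.sum_congr rfl fun _ _ => by ring

/-- The subgroup `L` contains all the weights of `a`. -/
def Wt (a : Matrix (Fin n) (Fin n) k) (L : AddSubgroup k) : Prop :=
  (∀ μ, (TL a).HasEigenvalue μ → μ ∈ L) ∧ a.trace ∈ L

theorem exists_Wt (a : Matrix (Fin n) (Fin n) k) (c : k) :
    ∃ S : Set k, S.Finite ∧ Wt a (AddSubgroup.closure S) ∧ c ∈ AddSubgroup.closure S := by
  refine ⟨{μ | (TL a).HasEigenvalue μ} ∪ {a.trace, c},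
    (Module.End.finite_hasEigenvalue _).union (by simp), ⟨?_, ?_⟩, ?_⟩
  · intro μ hμ; exact AddSubgroup.subset_closure (Or.inl hμ)
  · exact AddSubgroup.subset_closure (by simp)
  · exact AddSubgroup.subset_closure (by simp)

theorem spans_lin [IsAlgClosed k] (a : Matrix (Fin n) (Fin n) k) : Spans (TL a) :=
  Module.End.iSup_maxGenEigenspace_eq_top _

theorem hasEig {V : Type*} [AddCommGroup V] [Module k V] {T : Module.End k V} {μ : k}
    (hne : T.maxGenEigenspace μ ≠ ⊥) : T.HasEigenvalue μ :=
  Module.End.HasUnifEigenvalue.lt zero_lt_one (show Module.End.HasUnifEigenvalue T μ ⊤ from hne)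

theorem spansIn_lin [IsAlgClosed k] {a : Matrix (Fin n) (Fin n) k} {L : AddSubgroup k}
    (h : Wt a L) : SpansIn (TL a) L := by
  rw [SpansIn, eq_top_iff, ← show _ = _ from spans_lin a]
  refine iSup_le fun μ => ?_
  by_cases hμ : μ ∈ L
  · exact le_iSup (fun μ : L => (TL a).maxGenEigenspace (μ : k)) ⟨μ, hμ⟩
  · have : (TL a).maxGenEigenspace μ = ⊥ := by
      by_contra hne
      apply hμ
      apply h.1
      exact hasEig hne
    rw [this]; exact bot_le

theorem spansIn_DD [IsAlgClosed k] {a : Matrix (Fin n) (Fin n) k} {L : AddSubgroup k}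
    (h : Wt a L) : SpansIn (DD a : PR n k →ₗ[k] PR n k) L := by
  set S := ⨆ μ : L, Module.End.maxGenEigenspace (DD a : PR n k →ₗ[k] PR n k) (μ : k) with hS
  have hmem : ∀ μ ∈ L, ∀ f ∈ Module.End.maxGenEigenspace (DD a : PR n k →ₗ[k] PR n k) μ, f ∈ S :=
    fun μ hμ f hf => Submodule.mem_iSup_of_mem (⟨μ, hμ⟩ : L) hf
  have hmul : ∀ f ∈ S, ∀ g ∈ S, f * g ∈ S := by
    intro f hf g hg
    refine Submodule.iSup_induction _ (motive := fun f => f * g ∈ S) hf ?_ ?_ ?_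
    · intro μ f hf
      refine Submodule.iSup_induction _ (motive := fun g => f * g ∈ S) hg ?_ ?_ ?_
      · intro ν g hg
        exact hmem _ (L.add_mem μ.2 ν.2) _ (maxGen_mul (DD a) hf hg)
      · simp
      · intro x y hx hy; rw [mul_add]; exact S.add_mem hx hy
    · simp
    · intro x y hx hy; rw [add_mul]; exact S.add_mem hx hy
  have hX : ∀ i, (MvPolynomial.X i : PR n k) ∈ S := by
    rintro (⟨i, j⟩ | v)
    · rw [← rowF_single]
      have : ∀ w : Fin n → k, rowF i w ∈ S := by
        intro w
        induction w using spansIn_induction (spansIn_lin h) with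
        | h1 μ hμ w hw => exact hmem μ hμ _ (map_maxGen (rowF i) (DD_rowF a i) hw)
        | h2 v w hv hw => rw [map_add]; exact S.add_mem hv hw
      exact this _
    · refine hmem (-a.trace) (L.neg_mem h.2) _ ?_
      rw [Module.End.mem_maxGenEigenspace]
      refine ⟨1, ?_⟩
      simp [MvPolynomial.smul_eq_C_mul]
  rw [SpansIn, eq_top_iff]
  intro f _
  rw [← hS]
  have h1 : (1 : PR n k) ∈ S := hmem 0 L.zero_mem _ (maxGen_one _)
  induction f using MvPolynomial.induction_on with
  | C a =>
    rw [← mul_one (MvPolynomial.C a), ← MvPolynomial.smul_eq_C_mul]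
    exact S.smul_mem _ h1
  | add p q hp hq => exact S.add_mem (hp trivial) (hq trivial)
  | mul_X p i hp => exact hmul _ (hp trivial) _ (hX i)

/-- The matrix acting by the scalar `c μ` on generalized eigenspaces. -/
noncomputable def opM (a : Matrix (Fin n) (Fin n) k) (c : k → k) : Matrix (Fin n) (Fin n) k :=
  LinearMap.toMatrix' (op (TL a) c)

theorem ev_op_X [IsAlgClosed k] {a : Matrix (Fin n) (Fin n) k} {L : AddSubgroup k}
    (h : Wt a L) (c : k → k) (i j : Fin n) :
    ev 1 (op (DD a : PR n k →ₗ[k] PR n k) c (MvPolynomial.X (Sum.inl (i, j)))) = opM a c i j := by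
  rw [← rowF_single, ← op_comm (spans_lin a) (spansIn_DD h).spans (rowF i) (DD_rowF a i),
    ev_one_rowF, opM, LinearMap.toMatrix'_apply]

theorem op_DD_stable [IsAlgClosed k] {a : Matrix (Fin n) (Fin n) k} {L : AddSubgroup k}
    (h : Wt a L) {H : Subgroup (GL (Fin n) k)} (ha : a ∈ LieH H) (c : k → k) (f : PR n k)
    (hf : f ∈ JJ H) : op (DD a : PR n k →ₗ[k] PR n k) c f ∈ JJ H :=
  op_stable (spansIn_DD h).spans (p := (JJ H).restrictScalars k) (fun f hf => ha f hf) c f hf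

theorem replica_lie [IsAlgClosed k] {a : Matrix (Fin n) (Fin n) k} {L : AddSubgroup k}
    (h : Wt a L) {H : Subgroup (GL (Fin n) k)} (ha : a ∈ LieH H) (c : k → k)
    (hc : ∀ a ∈ L, ∀ b ∈ L, c (a + b) = c a + c b) : opM a c ∈ LieH H := by
  refine (point_der (H := H) ((ev 1).toLinearMap ∘ₗ op (DD a : PR n k →ₗ[k] PR n k) c)
    ?_ ?_ _ ?_).1
  · intro f g
    simp only [LinearMap.comp_apply, AlgHom.toLinearMap_apply]
    rw [op_leibniz (spansIn_DD h) c hc, map_add, map_mul, map_mul]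
  · intro f hf
    exact op_DD_stable h ha c f hf 1 H.one_mem
  · intro i j
    exact ev_op_X h c i j

theorem replica_grp [IsAlgClosed k] {a : Matrix (Fin n) (Fin n) k} {L : AddSubgroup k}
    (h : Wt a L) {H : Subgroup (GL (Fin n) k)} (hH : Cl H) (ha : a ∈ LieH H) (c : k → k)
    (hc0 : c 0 = 1)
    (hc : ∀ a ∈ L, ∀ b ∈ L, c (a + b) = c a * c b) :
    ∃ g ∈ H, (g : Matrix (Fin n) (Fin n) k) = opM a c ∧
      ∀ f, ev g f = ev 1 (op (DD a : PR n k →ₗ[k] PR n k) c f) := by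
  have hone : op (DD a : PR n k →ₗ[k] PR n k) c 1 = 1 := by
    rw [op_apply (spansIn_DD h).spans c (maxGen_one (DD a)), hc0, one_smul]
  let ψ : PR n k →ₐ[k] k := AlgHom.ofLinearMap
    ((ev 1).toLinearMap ∘ₗ op (DD a : PR n k →ₗ[k] PR n k) c) (by simp [hone])
    (by intro x y
        simp only [LinearMap.comp_apply, AlgHom.toLinearMap_apply]
        rw [op_mul_apply (spansIn_DD h) c hc, map_mul])
  have hψ : ∀ f, ψ f = ev 1 (op (DD a : PR n k →ₗ[k] PR n k) c f) := fun f => rfl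
  have hJ : ∀ f ∈ JJ H, ψ f = 0 := fun f hf => op_DD_stable h ha c f hf 1 H.one_mem
  have hdet : ψ (detP n k) = (opM a c).det := by
    rw [detP, AlgHom.map_det]
    congr 1
    ext i j
    simp [hψ, ev_op_X h]
  have hu : (opM a c).det * ψ (MvPolynomial.X (Sum.inr ())) = 1 := by
    have := hJ _ (detP_mem H)
    rw [map_sub, map_mul, hdet, map_one] at this
    linear_combination this
  have hunit : IsUnit (opM a c).det := IsUnit.of_mul_eq_one _ hu
  let g : GL (Fin n) k := Matrix.GeneralLinearGroup.mk'' (opM a c) hunit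
  have hg : (g : Matrix (Fin n) (Fin n) k) = opM a c := rfl
  have hev : ev g = ψ := by
    ext i
    rcases i with ⟨i, j⟩ | v
    · simp [hg, hψ, ev_op_X h]
    · have h1 : (g : Matrix (Fin n) (Fin n) k).det *
          ((g⁻¹ : GL (Fin n) k) : Matrix (Fin n) (Fin n) k).det = 1 := by
        rw [← Matrix.det_mul, ← Units.val_mul]; simp
      rw [ev_inr]
      rw [hg] at h1
      exact mul_left_cancel₀ hunit.ne_zero (h1.trans hu.symm)
  refine ⟨g, hH g fun f hf => ?_, hg, fun f => ?_⟩
  · rw [hev]; exact hJ f hf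
  · rw [hev, hψ]

theorem laurent_mono (m : ℤ) : ∃ p : MvPolynomial Bool k, ∀ t : kˣ,
    ((t ^ m : kˣ) : k) = MvPolynomial.eval (fun b => if b then (t : k) else ((t⁻¹ : kˣ) : k)) p := by
  obtain ⟨m, rfl | rfl⟩ := m.eq_nat_or_neg
  · exact ⟨MvPolynomial.X true ^ m, fun t => by simp⟩
  · exact ⟨MvPolynomial.X false ^ m, fun t => by simp⟩

theorem replica_onePS [IsAlgClosed k] (G : AlgGroup k) {a : Matrix (Fin G.n) (Fin G.n) k}
    {L : AddSubgroup k}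
    (h : Wt a L) {H : Subgroup (GL (Fin G.n) k)} (hHG : H ≤ G.toSubgroup) (hH : Cl H)
    (ha : a ∈ LieH H) (z : k → ℤ)
    (hz : ∀ a ∈ L, ∀ b ∈ L, z (a + b) = z a + z b) :
    ∃ lam : OnePS G, (∀ t, lam.toFun t ∈ H) ∧
      (∀ t f, ev (lam.toFun t) f = ev 1 (op (DD a : PR G.n k →ₗ[k] PR G.n k)
        (fun μ => ((t ^ z μ : kˣ) : k)) f)) ∧
      ∀ t μ, ∀ w ∈ (TL a).maxGenEigenspace μ,
        (lam.toFun t : Matrix (Fin G.n) (Fin G.n) k).mulVec w = ((t ^ z μ : kˣ) : k) • w := by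
  have hz0 : z 0 = 0 := by
    have := hz 0 L.zero_mem 0 L.zero_mem
    rw [add_zero] at this
    omega
  have hex : ∀ t : kˣ, _ := fun t => replica_grp h hH ha (fun μ => ((t ^ z μ : kˣ) : k))
    (by simp [hz0]) (by intro a ha b hb; simp [hz a ha b hb, zpow_add])
  choose φ hφ1 hφ2 hφ3 using hex
  have hact : ∀ t w, (φ t : Matrix (Fin G.n) (Fin G.n) k).mulVec w =
      op (TL a) (fun μ => ((t ^ z μ : kˣ) : k)) w := by
    intro t w
    rw [hφ2, opM, ← Matrix.toLin'_apply, Matrix.toLin'_toMatrix']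
  have hmul : ∀ s t, φ (s * t) = φ s * φ t := by
    intro s t
    apply Units.ext
    rw [Units.val_mul, hφ2, hφ2, hφ2, opM, opM, opM, ← LinearMap.toMatrix'_mul, ← op_mul (spans_lin a)]
    congr 2
    funext μ
    rw [mul_zpow, Units.val_mul]
  have hone : φ 1 = 1 := by
    have := hmul 1 1
    rw [one_mul] at this
    exact mul_eq_left.mp this.symm
  have hreg : ∀ w : Fin G.n → k, ∀ i, ∃ p : MvPolynomial Bool k, ∀ t : kˣ,
      op (TL a) (fun μ => ((t ^ z μ : kˣ) : k)) w i =
        MvPolynomial.eval (fun b => if b then (t : k) else ((t⁻¹ : kˣ) : k)) p := by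
    intro w i
    induction w using spans_induction (spans_lin a) with
    | h1 μ w hw =>
      obtain ⟨p, hp⟩ := laurent_mono (k := k) (z μ)
      refine ⟨p * MvPolynomial.C (w i), fun t => ?_⟩
      rw [op_apply (spans_lin a) _ hw, map_mul, ← hp]
      simp
    | h2 v w hv hw =>
      obtain ⟨p, hp⟩ := hv
      obtain ⟨q, hq⟩ := hw
      refine ⟨p + q, fun t => ?_⟩
      rw [map_add, map_add, ← hp, ← hq]; rfl
  refine ⟨⟨⟨⟨φ, hone⟩, hmul⟩, fun t => hHG (hφ1 t), ?_⟩, hφ1, hφ3, ?_⟩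
  · choose p hp using fun ij : Fin G.n × Fin G.n => hreg (Pi.single ij.2 1) ij.1
    refine ⟨p, fun t ij => ?_⟩
    rw [← hp, ← hact]
    simp
  · intro t μ w hw
    exact (hact t w).trans (op_apply (spans_lin a) _ hw)

end stepR


section engel
attribute [local instance] LieRing.ofAssociativeRing
variable {k : Type} [Field k]

theorem engel {V : Type*} [AddCommGroup V] [Module k V] [FiniteDimensional k V]
    (p : Submodule k (Module.End k V)) (hlie : ∀ a ∈ p, ∀ b ∈ p, a * b - b * a ∈ p)
    (hnil : ∀ a ∈ p, IsNilpotent a) :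
    ∃ (F : ℕ → Submodule k V) (N : ℕ), F 0 = ⊤ ∧ F N = ⊥ ∧ Antitone F ∧
      ∀ r ∈ p, ∀ i, ∀ w ∈ F i, r w ∈ F (i + 1) := by
  let L : LieSubalgebra k (Module.End k V) :=
    { p with lie_mem' := by intro a b ha hb; exact hlie a ha b hb }
  have h : LieModule.IsNilpotent L V := by
    rw [LieModule.isNilpotent_iff_forall' (R := k)]
    intro x
    exact hnil x.1 x.2
  obtain ⟨N, hN⟩ := (LieModule.isNilpotent_iff k L V).mp h
  refine ⟨fun i => (LieModule.lowerCentralSeries k L V i).toSubmodule, N, ?_, ?_, ?_, ?_⟩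
  · simp
  · simp [hN]
  · intro i j hij
    exact LieModule.antitone_lowerCentralSeries k L V hij
  · intro r hr i w hw
    have : ⁅(⟨r, hr⟩ : L), w⁆ ∈ LieModule.lowerCentralSeries k L V (i + 1) := by
      rw [LieModule.lowerCentralSeries_succ]
      exact LieSubmodule.lie_mem_lie (LieSubmodule.mem_top _) hw
    exact this

end engel

section trace
variable {k : Type} [Field k]

theorem nilp_of_eig [IsAlgClosed k] {V : Type*} [AddCommGroup V] [Module k V]
    [FiniteDimensional k V] (T : Module.End k V) (h : ∀ μ, T.HasEigenvalue μ → μ = 0) :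
    IsNilpotent T := by
  have h1 : T.maxGenEigenspace 0 = ⊤ := by
    rw [eq_top_iff, ← Module.End.iSup_maxGenEigenspace_eq_top T]
    refine iSup_le fun μ => ?_
    by_cases hμ : T.maxGenEigenspace μ = ⊥
    · rw [hμ]; exact bot_le
    · rw [h μ (hasEig hμ)]
  rw [Module.End.isNilpotent_iff_of_finite]
  intro m
  have hm : m ∈ T.maxGenEigenspace 0 := by rw [h1]; trivial
  rw [Module.End.mem_maxGenEigenspace] at hm
  simpa using hm

theorem trace_op [IsAlgClosed k] {V : Type*} [AddCommGroup V] [Module k V]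
    [FiniteDimensional k V] (T : Module.End k V) (c : k → k) :
    ∃ F : Finset k, (∀ μ, μ ∈ F ↔ T.maxGenEigenspace μ ≠ ⊥) ∧
      LinearMap.trace k V (op T c * T) =
        ∑ μ ∈ F, (Module.finrank k (T.maxGenEigenspace μ) : k) * c μ * μ := by
  classical
  have hs : Spans T := Module.End.iSup_maxGenEigenspace_eq_top T
  have h_fin : {μ | T.maxGenEigenspace μ ≠ ⊥}.Finite :=
    WellFoundedGT.finite_ne_bot_of_iSupIndep T.independent_maxGenEigenspace
  refine ⟨h_fin.toFinset, by simp, ?_⟩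
  have hT : ∀ μ, Set.MapsTo T (T.maxGenEigenspace μ) (T.maxGenEigenspace μ) :=
    fun μ => T.mapsTo_maxGenEigenspace_of_comm (Commute.refl _) μ
  have hf : ∀ μ, Set.MapsTo (op T c * T) (T.maxGenEigenspace μ) (T.maxGenEigenspace μ) := by
    intro μ x hx
    have h1 := hT μ hx
    show op T c (T x) ∈ _
    rw [op_apply hs c h1]
    exact Submodule.smul_mem _ _ h1
  rw [LinearMap.trace_eq_sum_trace_restrict' (spans_internal hs) h_fin hf]
  refine Finset.sum_congr rfl fun μ _ => ?_
  have e1 : (op T c * T).restrict (hf μ) = c μ • (T.restrict (hT μ)) := by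
    ext x
    show op T c (T x) = c μ • T x
    exact op_apply hs c (hT μ x.2)
  have hn := T.isNilpotent_restrict_maxGenEigenspace_sub_algebraMap μ
  have ht := (LinearMap.isNilpotent_trace_of_isNilpotent hn).eq_zero
  have e2 : T.restrict (hT μ) = (T - algebraMap k (Module.End k V) μ).restrict
      (T.mapsTo_maxGenEigenspace_of_comm (Algebra.mul_sub_algebraMap_commutes T μ) μ) +
      μ • LinearMap.id := by
    ext x
    show T x = (T x - μ • (x : V)) + μ • (x : V)
    abel
  rw [e1, map_smul, e2, map_add, ht, map_smul, LinearMap.trace_id]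
  simp; ring

theorem z_sum {L : AddSubgroup k} {z : k → ℤ} (hz : ∀ a ∈ L, ∀ b ∈ L, z (a + b) = z a + z b)
    (F : Finset k) (hF : ∀ μ ∈ F, μ ∈ L) (m : k → ℤ) (h0 : ∑ μ ∈ F, (m μ : k) * μ = 0) :
    ∑ μ ∈ F, m μ * z μ = 0 := by
  let zL : L →+ ℤ := AddMonoidHom.mk' (fun a => z a) (fun a b => hz a a.2 b b.2)
  have h1 : ∑ μ : F, m μ • (⟨μ, hF μ μ.2⟩ : L) = 0 := by
    apply Subtype.ext
    rw [AddSubgroup.coe_zero, ← h0, ← Finset.sum_coe_sort F]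
    simp
  have h2 := congrArg zL h1
  rw [map_sum, map_zero] at h2
  rw [← Finset.sum_coe_sort F, ← h2]
  refine Finset.sum_congr rfl fun μ _ => ?_
  rw [map_zsmul]; rfl

theorem nilp_of_rad [IsAlgClosed k] [CharZero k] {n : ℕ} {H : Subgroup (GL (Fin n) k)}
    {a : Matrix (Fin n) (Fin n) k} (ha : a ∈ LieH H)
    (h : ∀ b ∈ LieH H, (a * b).trace = 0) : IsNilpotent a := by
  by_contra hn
  have : ∃ μ, (TL a).HasEigenvalue μ ∧ μ ≠ 0 := by
    by_contra! hc
    exact hn ((Matrix.isNilpotent_toLin'_iff a).mp (nilp_of_eig (TL a) hc))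
  obtain ⟨μ, hμ, hμ0⟩ := this
  obtain ⟨S, hS, hW, -⟩ := exists_Wt a 0
  obtain ⟨z, hz, hzμ⟩ := exists_z S hS μ (hW.1 μ hμ) hμ0
  have hb := replica_lie hW ha (fun ν => (z ν : k)) (by intro a ha b hb; simp [hz a ha b hb])
  have ht := h _ hb
  obtain ⟨F, hF, htr⟩ := trace_op (TL a) (fun ν => (z ν : k))
  have e : LinearMap.trace k _ (op (TL a) (fun ν => (z ν : k)) * TL a) = 0 := by
    have e2 : opM a (fun ν => (z ν : k)) * a =
        LinearMap.toMatrix' (op (TL a) (fun ν => (z ν : k)) * TL a) := by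
      rw [LinearMap.toMatrix'_mul, opM, LinearMap.toMatrix'_toLin']
    rw [← ht, Matrix.trace_mul_comm, e2,
      LinearMap.trace_eq_matrix_trace k (Pi.basisFun k (Fin n))]
    rfl
  rw [htr] at e
  have := z_sum hz F (fun ν hν => hW.1 ν (hasEig ((hF ν).mp hν)))
    (fun ν => (Module.finrank k ((TL a).maxGenEigenspace ν) : ℤ) * z ν) (by simpa using e)
  have hpos : 0 < ∑ ν ∈ F, (Module.finrank k ((TL a).maxGenEigenspace ν) : ℤ) * z ν * z ν := by
    refine Finset.sum_pos' (fun ν _ => ?_) ⟨μ, ?_, ?_⟩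
    · rw [mul_assoc]; exact mul_nonneg (by positivity) (mul_self_nonneg _)
    · rw [hF]
      intro h0
      obtain ⟨v, hv⟩ := hμ.exists_hasEigenvector
      apply hv.2
      have := Module.End.eigenspace_le_maxGenEigenspace hv.1
      rw [h0] at this
      simpa using this
    · rw [mul_assoc]
      refine mul_pos ?_ (mul_self_pos.mpr hzμ)
      have : 0 < Module.finrank k ((TL a).maxGenEigenspace μ) := by
        rw [Nat.pos_iff_ne_zero, Ne, Submodule.finrank_eq_zero]
        intro h0
        obtain ⟨v, hv⟩ := hμ.exists_hasEigenvector
        apply hv.2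
        have := Module.End.eigenspace_le_maxGenEigenspace hv.1
        rw [h0] at this
        simpa using this
      exact_mod_cast this
  exact hpos.ne' this

end trace


section expo
variable {k : Type} [Field k] [CharZero k] {n : ℕ}

theorem nilp_pow {a : Matrix (Fin n) (Fin n) k} (h : IsNilpotent a) : a ^ n = 0 := by
  have h1 : IsNilpotent (Matrix.toLin' a) := (Matrix.isNilpotent_toLin'_iff a).mpr h
  have h2 := h1.charpoly_eq_X_pow_finrank
  rw [Matrix.charpoly_toLin', Module.finrank_fin_fun] at h2
  have h3 := Matrix.aeval_self_charpoly a
  rwa [h2, map_pow, Polynomial.aeval_X] at h3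

/-- The exponential curve. -/
noncomputable def Gam (r : Matrix (Fin n) (Fin n) k) : Matrix (Fin n) (Fin n) (Polynomial k) :=
  Matrix.of fun i j => ∑ m ∈ Finset.range n,
    Polynomial.C (((m.factorial : k))⁻¹ * (r ^ m) i j) * Polynomial.X ^ m

theorem exp_apply {r : Matrix (Fin n) (Fin n) k} (h : IsNilpotent r) (s : k) (i j : Fin n) :
    IsNilpotent.exp (s • r) i j = (Gam r i j).eval s := by
  have h1 : (s • r) ^ n = 0 := by rw [smul_pow, nilp_pow h, smul_zero]
  rw [IsNilpotent.exp_eq_sum h1, Gam, Matrix.of_apply, Polynomial.eval_finset_sum,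
    Matrix.sum_apply]
  refine Finset.sum_congr rfl fun m _ => ?_
  simp only [smul_pow, Matrix.smul_apply, Polynomial.eval_mul, Polynomial.eval_C,
    Polynomial.eval_pow, Polynomial.eval_X, smul_eq_mul, Rat.smul_def]
  push_cast
  ring

theorem der_Gam {r : Matrix (Fin n) (Fin n) k} (h : IsNilpotent r) (i j : Fin n) :
    Polynomial.derivative (Gam r i j) = ∑ l, Polynomial.C (r l j) * Gam r i l := by
  have h0 := nilp_pow h
  have e1 : ∑ l, Polynomial.C (r l j) * Gam r i l = ∑ m ∈ Finset.range n,
      Polynomial.C (((m.factorial : k))⁻¹ * (r ^ (m + 1)) i j) * Polynomial.X ^ m := by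
    simp only [Gam, Matrix.of_apply, Finset.mul_sum]
    rw [Finset.sum_comm]
    refine Finset.sum_congr rfl fun m _ => ?_
    rw [pow_succ, Matrix.mul_apply, Finset.mul_sum, map_sum, Finset.sum_mul]
    refine Finset.sum_congr rfl fun l _ => ?_
    simp only [map_mul]; ring
  rw [e1, Gam, Matrix.of_apply, map_sum]
  rcases n with _ | n
  · simp
  rw [Finset.sum_range_succ', Finset.sum_range_succ (n := n)]
  simp only [h0]
  simp
  refine Finset.sum_congr rfl fun m _ => ?_
  have : ((m.factorial : k)) ≠ 0 := by exact_mod_cast m.factorial_ne_zero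
  have h2 : ((m : k) + 1) ≠ 0 := by exact_mod_cast m.succ_ne_zero
  rw [Nat.factorial_succ]
  push_cast
  have : (((m : k) + 1) * (m.factorial : k))⁻¹ * ((m : k) + 1) = (m.factorial : k)⁻¹ := by
    field_simp
  rw [← this]
  simp only [map_mul, map_add, map_natCast, map_one]
  ring

/-- Pull back along the exponential curve. -/
noncomputable def phiG (r : Matrix (Fin n) (Fin n) k) : PR n k →ₐ[k] Polynomial k :=
  MvPolynomial.aeval (Sum.elim (fun ij => Gam r ij.1 ij.2) (fun _ => 1))

theorem der_phiG {r : Matrix (Fin n) (Fin n) k} (h : IsNilpotent r) (f : PR n k) :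
    Polynomial.derivative (phiG r f) = phiG r (DD r f) := by
  have htr : r.trace = 0 := (Matrix.isNilpotent_trace_of_isNilpotent h).eq_zero
  have : (Polynomial.derivative (R := k)) ∘ₗ (phiG r).toLinearMap =
      (phiG r).toLinearMap ∘ₗ (DD r : PR n k →ₗ[k] PR n k) := by
    refine der_ext (phiG r) _ _ ?_ ?_ ?_
    · intro f g; simp [Polynomial.derivative_mul]; ring
    · intro f g; simp
    · rintro (⟨i, j⟩ | v)
      · simp [phiG, der_Gam h, Polynomial.algebraMap_eq]
      · simp [phiG, htr]
  exact LinearMap.congr_fun this f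

theorem eval_zero_phiG {r : Matrix (Fin n) (Fin n) k} (h : IsNilpotent r) (f : PR n k) :
    (phiG r f).eval 0 = ev 1 f := by
  have : (Polynomial.aeval (0 : k)).comp (phiG r) = ev 1 := by
    ext i
    rcases i with ⟨i, j⟩ | v
    · simp [phiG, ← exp_apply h, IsNilpotent.exp_zero]
    · simp [phiG]
  rw [← this]
  simp [Polynomial.coe_aeval_eq_eval]

theorem poly_zero {p : Polynomial k} (h : ∀ m, (Polynomial.derivative^[m] p).eval 0 = 0) : p = 0 := by
  ext m
  have := h m
  rw [← Polynomial.coeff_zero_eq_eval_zero, Polynomial.coeff_iterate_derivative] at this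
  simp only [zero_add, Nat.descFactorial_self, nsmul_eq_mul, mul_eq_zero] at this
  rcases this with h | h
  · exact absurd h (by exact_mod_cast m.factorial_ne_zero)
  · simpa using h

theorem phiG_zero {r : Matrix (Fin n) (Fin n) k} (h : IsNilpotent r) {H : Subgroup (GL (Fin n) k)}
    (hr : r ∈ LieH H) {f : PR n k} (hf : f ∈ JJ H) : phiG r f = 0 := by
  have h1 : ∀ m : ℕ, ∃ g ∈ JJ H, Polynomial.derivative^[m] (phiG r f) = phiG r g := by
    intro m
    induction m with
    | zero => exact ⟨f, hf, rfl⟩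
    | succ m ih =>
      obtain ⟨g, hg, e⟩ := ih
      refine ⟨DD r g, hr g hg, ?_⟩
      rw [Function.iterate_succ_apply', e, der_phiG h]
  refine poly_zero fun m => ?_
  obtain ⟨g, hg, e⟩ := h1 m
  rw [e, eval_zero_phiG h]
  exact hg 1 H.one_mem

/-- The exponential as a group element. -/
noncomputable def EE {r : Matrix (Fin n) (Fin n) k} (h : IsNilpotent r) : GL (Fin n) k :=
  ⟨IsNilpotent.exp r, IsNilpotent.exp (-r), IsNilpotent.exp_mul_exp_neg_self h,
    IsNilpotent.exp_neg_mul_exp_self h⟩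

theorem EE_val {r : Matrix (Fin n) (Fin n) k} (h : IsNilpotent r) :
    (EE h : Matrix (Fin n) (Fin n) k) = IsNilpotent.exp r := rfl

theorem EE_mem {r : Matrix (Fin n) (Fin n) k} (h : IsNilpotent r) {H : Subgroup (GL (Fin n) k)}
    (hH : Cl H) (hr : r ∈ LieH H) : EE h ∈ H := by
  have hval : ∀ i j, (EE h : Matrix (Fin n) (Fin n) k) i j = (Gam r i j).eval 1 := by
    intro i j
    rw [EE_val, ← exp_apply h, one_smul]
  let ψ : PR n k →ₐ[k] k := (Polynomial.aeval (1 : k)).comp (phiG r)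
  have hψ : ∀ f, ψ f = (phiG r f).eval 1 := fun f => by simp [ψ, Polynomial.coe_aeval_eq_eval]
  have hJ : ∀ f ∈ JJ H, ψ f = 0 := fun f hf => by rw [hψ, phiG_zero h hr hf]; simp
  have hd : ψ (MvPolynomial.X (Sum.inr ())) = 1 := by simp [hψ, phiG]
  have hX : ∀ i j, ψ (MvPolynomial.X (Sum.inl (i, j))) = (EE h : Matrix (Fin n) (Fin n) k) i j := by
    intro i j; simp [hψ, phiG, hval]
  have hdet : (EE h : Matrix (Fin n) (Fin n) k).det = 1 := by
    have h1 := hJ _ (detP_mem H)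
    rw [map_sub, map_mul, hd, map_one, mul_one, sub_eq_zero, detP, AlgHom.map_det] at h1
    rw [← h1]
    congr 1
    ext i j
    simp [hX]
  have hev : ev (EE h) = ψ := by
    ext i
    rcases i with ⟨i, j⟩ | v
    · simp [hX]
    · have h1 : (EE h : Matrix (Fin n) (Fin n) k).det *
          (((EE h)⁻¹ : GL (Fin n) k) : Matrix (Fin n) (Fin n) k).det = 1 := by
        rw [← Matrix.det_mul, ← Units.val_mul]; simp
      rw [hdet, one_mul] at h1
      rw [ev_inr, h1]; exact hd.symm
  exact hH _ fun f hf => by rw [hev]; exact hJ f hf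

theorem conn_of_curves {T : Set (GL (Fin n) k)} (h1 : (1 : GL (Fin n) k) ∈ T)
    (hc : ∀ h ∈ T, ∃ γ : Matrix (Fin n) (Fin n) (Polynomial k),
      (∀ s : k, ∃ u ∈ T, ∀ i j, (u : Matrix (Fin n) (Fin n) k) i j = (γ i j).eval s) ∧
      (∀ i j, (1 : Matrix (Fin n) (Fin n) k) i j = (γ i j).eval 0) ∧
      (∀ i j, (h : Matrix (Fin n) (Fin n) k) i j = (γ i j).eval 1)) : IsConnSet T := by
  have key : ∀ V W : Set (GL (Fin n) k), ClosedInGL V → ClosedInGL W →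
      T ⊆ V ∪ W → T ∩ V ∩ W = ∅ → (1 : GL (Fin n) k) ∈ V → T ⊆ V := by
    rintro V W ⟨I, rfl⟩ ⟨I', rfl⟩ hVW hd h1V h hh
    by_contra hhV
    obtain ⟨γ, hγ, hγ0, hγ1⟩ := hc h hh
    have h1W : (1 : GL (Fin n) k) ∉
        {A : GL (Fin n) k | mat2pt (A : Matrix (Fin n) (Fin n) k) ∈ zeroLocus I'} := by
      intro hW
      have : (1 : GL (Fin n) k) ∈ (∅ : Set (GL (Fin n) k)) := hd ▸ ⟨⟨h1, h1V⟩, hW⟩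
      exact this
    simp only [zeroLocus, Set.mem_setOf_eq, not_forall] at hhV h1W
    obtain ⟨f, hf, hf0⟩ := hhV
    obtain ⟨f', hf', hf0'⟩ := h1W
    let Φ : MvPolynomial (Fin n × Fin n) k →ₐ[k] Polynomial k :=
      MvPolynomial.aeval (fun ij => γ ij.1 ij.2)
    have hΦ : ∀ (u : Matrix (Fin n) (Fin n) k) (s : k), (∀ i j, u i j = (γ i j).eval s) →
        ∀ g, (Φ g).eval s = MvPolynomial.eval (mat2pt u) g := by
      intro u s hu g
      have : (Polynomial.aeval s).comp Φ = MvPolynomial.aeval (mat2pt u) := by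
        ext ij
        simp [Φ, mat2pt, hu, Polynomial.coe_aeval_eq_eval]
      have := DFunLike.congr_fun this g
      simpa [Polynomial.coe_aeval_eq_eval, MvPolynomial.aeval_eq_eval] using this
    have hprod : Φ f * Φ f' = 0 := by
      apply Polynomial.funext
      intro s
      obtain ⟨u, hu, hus⟩ := hγ s
      rw [Polynomial.eval_mul, hΦ u s hus, hΦ u s hus, Polynomial.eval_zero]
      rcases hVW hu with h | h
      · rw [h f hf, zero_mul]
      · rw [h f' hf', mul_zero]
    rcases mul_eq_zero.mp hprod with h | h
    · apply hf0
      rw [← hΦ _ 1 hγ1, h, Polynomial.eval_zero]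
    · apply hf0'
      rw [← hΦ _ 0 (by simpa using hγ0), h, Polynomial.eval_zero]
  intro V W hV hW hVW hd
  rcases hVW h1 with h | h
  · exact Or.inl (key V W hV hW hVW hd h)
  · refine Or.inr (key W V hW hV (by rwa [Set.union_comm]) ?_ h)
    rw [← hd, Set.inter_assoc, Set.inter_assoc, Set.inter_comm V W]

end expo


section nondeg
variable {k : Type} [Field k]

theorem Cl_of_AlgGroup (G : AlgGroup k) : Cl G.toSubgroup := by
  obtain ⟨I, hI⟩ := G.closed
  intro g hg
  rw [hI]
  intro f hf
  have e : ∀ u : GL (Fin G.n) k, ev u (MvPolynomial.rename Sum.inl f) =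
      MvPolynomial.eval (mat2pt (u : Matrix (Fin G.n) (Fin G.n) k)) f := by
    intro u
    have : (ev u).comp (MvPolynomial.rename Sum.inl) =
        MvPolynomial.aeval (mat2pt (u : Matrix (Fin G.n) (Fin G.n) k)) := by
      ext ⟨i, j⟩
      simp [mat2pt]
    have := DFunLike.congr_fun this f
    simpa [MvPolynomial.aeval_eq_eval] using this
  rw [← e]
  apply hg
  intro u hu
  rw [e]
  exact (hI u).mp hu f hf

variable [IsAlgClosed k] [CharZero k] {n : ℕ}

/-- The radical of the trace form. -/
noncomputable def Rad (H : Subgroup (GL (Fin n) k)) : Submodule k (Matrix (Fin n) (Fin n) k) where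
  carrier := {a | a ∈ LieH H ∧ ∀ b ∈ LieH H, (a * b).trace = 0}
  add_mem' := by
    rintro a b ⟨ha, ha'⟩ ⟨hb, hb'⟩
    refine ⟨(LieH H).add_mem ha hb, fun c hc => ?_⟩
    rw [add_mul, Matrix.trace_add, ha' c hc, hb' c hc, add_zero]
  zero_mem' := ⟨(LieH H).zero_mem, fun c _ => by simp⟩
  smul_mem' := by
    rintro s a ⟨ha, ha'⟩
    refine ⟨(LieH H).smul_mem s ha, fun c hc => ?_⟩
    rw [smul_mul_assoc, Matrix.trace_smul, ha' c hc, smul_zero]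

theorem Rad_nilp {H : Subgroup (GL (Fin n) k)} {a : Matrix (Fin n) (Fin n) k} (ha : a ∈ Rad H) :
    IsNilpotent a := nilp_of_rad ha.1 ha.2

theorem Rad_lie {H : Subgroup (GL (Fin n) k)} {a b : Matrix (Fin n) (Fin n) k} (ha : a ∈ Rad H)
    (hb : b ∈ Rad H) : a * b - b * a ∈ Rad H := by
  refine ⟨LieH_lie ha.1 hb.1, fun c hc => ?_⟩
  have h := ha.2 _ (LieH_lie hb.1 hc)
  have e1 : (a * b - b * a) * c = a * (b * c - c * b) + (a * c * b - b * (a * c)) := by noncomm_ring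
  rw [e1, Matrix.trace_add, h, Matrix.trace_sub, Matrix.trace_mul_comm (a * c) b]
  simp

theorem Rad_Ad {H : Subgroup (GL (Fin n) k)} {a : Matrix (Fin n) (Fin n) k} (ha : a ∈ Rad H)
    {g : GL (Fin n) k} (hg : g ∈ H) :
    (g : Matrix (Fin n) (Fin n) k) * a * ((g⁻¹ : GL (Fin n) k) : Matrix (Fin n) (Fin n) k) ∈ Rad H := by
  refine ⟨Ad_mem hg ha.1, fun c hc => ?_⟩
  have h := ha.2 _ (Ad_mem (H.inv_mem hg) hc)
  rw [inv_inv] at h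
  rw [← h, ← Matrix.mul_assoc, ← Matrix.mul_assoc, Matrix.trace_mul_comm _ (g : Matrix (Fin n) (Fin n) k)]
  simp only [Matrix.mul_assoc]

/-- The monoid generated by exponentials of the radical. -/
noncomputable def TT (H : Subgroup (GL (Fin n) k)) : Submonoid (GL (Fin n) k) :=
  Submonoid.closure {u | ∃ r, ∃ h : r ∈ Rad H, u = EE (Rad_nilp h)}

theorem TT_le {H : Subgroup (GL (Fin n) k)} (hH : Cl H) {u : GL (Fin n) k} (hu : u ∈ TT H) :
    u ∈ H := by
  induction hu using Submonoid.closure_induction with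
  | mem u hu => obtain ⟨r, h, rfl⟩ := hu; exact EE_mem _ hH h.1
  | one => exact H.one_mem
  | mul a b _ _ ha hb => exact H.mul_mem ha hb

theorem TT_inv {H : Subgroup (GL (Fin n) k)} {u : GL (Fin n) k} (hu : u ∈ TT H) : u⁻¹ ∈ TT H := by
  induction hu using Submonoid.closure_induction with
  | mem u hu =>
    obtain ⟨r, h, rfl⟩ := hu
    refine Submonoid.subset_closure ⟨-r, (Rad H).neg_mem h, ?_⟩
    apply Units.ext
    rfl
  | one => simp [(TT H).one_mem]
  | mul a b _ _ ha hb => rw [mul_inv_rev]; exact (TT H).mul_mem hb ha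

theorem TT_conj {H : Subgroup (GL (Fin n) k)} {g : GL (Fin n) k} (hg : g ∈ H)
    {u : GL (Fin n) k} (hu : u ∈ TT H) : g * u * g⁻¹ ∈ TT H := by
  induction hu using Submonoid.closure_induction with
  | mem u hu =>
    obtain ⟨r, h, rfl⟩ := hu
    refine Submonoid.subset_closure ⟨_, Rad_Ad h hg, ?_⟩
    apply Units.ext
    have hr := nilp_pow (Rad_nilp h)
    have hr' := nilp_pow (Rad_nilp (Rad_Ad h hg))
    have hp : ∀ m : ℕ, ((g : Matrix (Fin n) (Fin n) k) * r * ((g⁻¹ : GL (Fin n) k) : Matrix (Fin n) (Fin n) k)) ^ m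
        = (g : Matrix (Fin n) (Fin n) k) * r ^ m * ((g⁻¹ : GL (Fin n) k) : Matrix (Fin n) (Fin n) k) := by
      intro m
      exact Units.conj_pow g r m
    rw [Units.val_mul, Units.val_mul, EE_val, EE_val, IsNilpotent.exp_eq_sum hr,
      IsNilpotent.exp_eq_sum hr', Finset.mul_sum, Finset.sum_mul]
    refine Finset.sum_congr rfl fun m _ => ?_
    rw [hp, mul_smul_comm, smul_mul_assoc]
  | one => simp [(TT H).one_mem]
  | mul a b _ _ ha hb =>
    have : g * (a * b) * g⁻¹ = (g * a * g⁻¹) * (g * b * g⁻¹) := by group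
    rw [this]; exact (TT H).mul_mem ha hb

theorem TT_conn (H : Subgroup (GL (Fin n) k)) : IsConnSet (TT H : Set (GL (Fin n) k)) := by
  refine conn_of_curves (TT H).one_mem ?_
  intro u hu
  have key : ∃ γ : Matrix (Fin n) (Fin n) (Polynomial k),
      (∀ s : k, ∃ u ∈ TT H, (u : Matrix (Fin n) (Fin n) k) = (Polynomial.evalRingHom s).mapMatrix γ) ∧
      1 = (Polynomial.evalRingHom 0).mapMatrix γ ∧
      (u : Matrix (Fin n) (Fin n) k) = (Polynomial.evalRingHom 1).mapMatrix γ := by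
    induction hu using Submonoid.closure_induction with
    | mem u hu =>
      obtain ⟨r, h, rfl⟩ := hu
      have e : ∀ s : k, IsNilpotent.exp (s • r) = (Polynomial.evalRingHom s).mapMatrix (Gam r) := by
        intro s; ext i j; rw [exp_apply (Rad_nilp h)]; simp
      refine ⟨Gam r, fun s => ⟨EE (Rad_nilp ((Rad H).smul_mem s h)),
        Submonoid.subset_closure ⟨_, (Rad H).smul_mem s h, rfl⟩, ?_⟩, ?_, ?_⟩
      · rw [EE_val, e]
      · rw [← e, zero_smul, IsNilpotent.exp_zero]
      · rw [← e, one_smul, EE_val]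
    | one =>
      exact ⟨1, fun s => ⟨1, (TT H).one_mem, by simp⟩, by simp, by simp⟩
    | mul a b _ _ ha hb =>
      obtain ⟨γ, h1, h2, h3⟩ := ha
      obtain ⟨γ', h1', h2', h3'⟩ := hb
      refine ⟨γ * γ', fun s => ?_, ?_, ?_⟩
      · obtain ⟨v, hv, e⟩ := h1 s
        obtain ⟨v', hv', e'⟩ := h1' s
        exact ⟨v * v', (TT H).mul_mem hv hv', by rw [map_mul, Units.val_mul, e, e']⟩
      · rw [map_mul, ← h2, ← h2', one_mul]
      · rw [map_mul, Units.val_mul, h3, h3']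
  obtain ⟨γ, h1, h2, h3⟩ := key
  refine ⟨γ, fun s => ?_, fun i j => ?_, fun i j => ?_⟩
  · obtain ⟨v, hv, e⟩ := h1 s
    exact ⟨v, hv, fun i j => by rw [e]; simp⟩
  · rw [h2]; simp
  · rw [h3]; simp

theorem TT_unip (H : Subgroup (GL (Fin n) k)) {u : GL (Fin n) k} (hu : u ∈ TT H) :
    IsUnipotentEl u := by
  obtain ⟨F, N, h0, hN, hanti, hF⟩ := engel
    ((Rad H).map (Matrix.toLin' : Matrix (Fin n) (Fin n) k ≃ₗ[k] _).toLinearMap) (by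
      rintro _ ⟨a, ha, rfl⟩ _ ⟨b, hb, rfl⟩
      refine ⟨a * b - b * a, Rad_lie ha hb, ?_⟩
      simp [Matrix.toLin'_mul, Module.End.mul_eq_comp]) (by
      rintro _ ⟨a, ha, rfl⟩
      exact (Matrix.isNilpotent_toLin'_iff a).mpr (Rad_nilp ha))
  have hF' : ∀ r ∈ Rad H, ∀ i, ∀ w ∈ F i, r.mulVec w ∈ F (i + 1) := by
    intro r hr i w hw
    have := hF _ ⟨r, hr, rfl⟩ i w hw
    simpa using this
  have key : ∀ i, ∀ w ∈ F i, (u : Matrix (Fin n) (Fin n) k).mulVec w - w ∈ F (i + 1) := by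
    induction hu using Submonoid.closure_induction with
    | mem u hu =>
      obtain ⟨r, h, rfl⟩ := hu
      intro i w hw
      have hr := nilp_pow (Rad_nilp h)
      have hr1 : r ^ (n + 1) = 0 := by rw [pow_succ, hr, zero_mul]
      have hp : ∀ m : ℕ, (r ^ (m + 1)).mulVec w ∈ F (i + 1) := by
        intro m
        induction m with
        | zero => simpa using hF' r h i w hw
        | succ m ih =>
          rw [pow_succ', ← Matrix.mulVec_mulVec]
          exact hanti (Nat.le_succ _) (hF' r h _ _ ih)
      rw [EE_val, IsNilpotent.exp_eq_sum hr1, Finset.sum_range_succ', Matrix.add_mulVec,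
        Matrix.sum_mulVec]
      simp only [pow_zero, Nat.factorial_zero, Nat.cast_one, inv_one, one_smul, Matrix.one_mulVec,
        add_sub_cancel_right]
      refine Submodule.sum_mem _ fun m _ => ?_
      have : (((((m + 1).factorial : ℚ)⁻¹) • r ^ (m + 1)).mulVec w) =
          ((((m + 1).factorial : ℚ)⁻¹ : ℚ) : k) • (r ^ (m + 1)).mulVec w := by
        rw [← Matrix.smul_mulVec]
        congr 1
        ext i j
        simp [Rat.smul_def]
      rw [this]
      exact Submodule.smul_mem _ _ (hp m)
    | one => intro i w _; simp
    | mul a b _ _ ha hb =>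
      intro i w hw
      rw [Units.val_mul, ← Matrix.mulVec_mulVec]
      have h1 := hb i w hw
      have h2 : (b : Matrix (Fin n) (Fin n) k).mulVec w ∈ F i := by
        have := (F i).add_mem (hanti (Nat.le_succ i) h1) hw
        simpa using this
      have h3 := ha i _ h2
      have := (F (i + 1)).add_mem h3 h1
      simpa using this
  have hnil : ((u : Matrix (Fin n) (Fin n) k) - 1) ^ N = 0 := by
    have h1 : ∀ (j : ℕ) (w : Fin n → k), (((u : Matrix (Fin n) (Fin n) k) - 1) ^ j).mulVec w ∈ F j := by
      intro j w
      induction j with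
      | zero => rw [h0]; trivial
      | succ j ih =>
        rw [pow_succ', ← Matrix.mulVec_mulVec, Matrix.sub_mulVec, Matrix.one_mulVec]
        exact key _ _ ih
    apply Matrix.toLin'.injective
    apply LinearMap.ext
    intro v
    have := h1 N v
    rw [hN, Submodule.mem_bot] at this
    rw [Matrix.toLin'_apply, this, map_zero, LinearMap.zero_apply]
  exact nilp_pow ⟨N, hnil⟩

theorem trace_nondeg (G : AlgGroup k) (hG : IsReductive G) {a : Matrix (Fin G.n) (Fin G.n) k}
    (ha : a ∈ LieH G.toSubgroup) (h : ∀ b ∈ LieH G.toSubgroup, (a * b).trace = 0) : a = 0 := by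
  have hcl := Cl_of_AlgGroup G
  have hsub : (TT G.toSubgroup : Set (GL (Fin G.n) k)) ⊆ idComponent G := by
    intro u hu
    exact ⟨_, ⟨fun v hv => TT_le hcl hv, (TT _).one_mem, TT_conn _⟩, hu⟩
  have hidc : ∀ g ∈ idComponent G, g ∈ G.toSubgroup := by
    rintro g ⟨C, ⟨hC, -⟩, hg⟩
    exact hC hg
  have h1 := hG (TT G.toSubgroup) hsub (TT _).one_mem (fun a ha b hb => (TT _).mul_mem ha hb)
    (fun a ha => TT_inv ha) (fun g hg u hu => TT_conj (hidc g hg) hu) (TT_conn _)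
    (fun u hu => TT_unip _ hu)
  have har : a ∈ Rad G.toSubgroup := ⟨ha, h⟩
  have hnil := Rad_nilp har
  have h2 : ∀ s : k, IsNilpotent.exp (s • a) = 1 := by
    intro s
    have : EE (Rad_nilp ((Rad G.toSubgroup).smul_mem s har)) ∈ (TT G.toSubgroup : Set _) :=
      Submonoid.subset_closure ⟨_, (Rad G.toSubgroup).smul_mem s har, rfl⟩
    rw [h1, Set.mem_singleton_iff] at this
    have := congrArg Units.val this
    exact this
  have h3 : ∀ i j, Gam a i j = Polynomial.C ((1 : Matrix (Fin G.n) (Fin G.n) k) i j) := by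
    intro i j
    apply Polynomial.funext
    intro s
    rw [← exp_apply hnil, h2, Polynomial.eval_C]
  ext i j
  have h4 := der_Gam hnil i j
  rw [h3, Polynomial.derivative_C] at h4
  have h5 := congrArg (Polynomial.eval 0) h4
  simp only [h3, Polynomial.eval_finset_sum, Polynomial.eval_mul, Polynomial.eval_C,
    Polynomial.eval_zero, Matrix.one_apply, mul_ite, mul_one, mul_zero, Finset.sum_ite_eq,
    Finset.mem_univ, if_true] at h5
  simp [h5]

end nondeg


section jm
variable {k : Type} [Field k] [IsAlgClosed k] [CharZero k]

theorem jacobson {V : Type*} [AddCommGroup V] [Module k V] [FiniteDimensional k V]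
    (X z c : Module.End k V) (hc : X * z - z * X = c) (hX : X * c = c * X) : IsNilpotent c := by
  classical
  refine nilp_of_eig c fun μ hμ => ?_
  by_contra hμ0
  have hs : Spans c := Module.End.iSup_maxGenEigenspace_eq_top c
  obtain ⟨F, hF, htr⟩ := trace_op c (fun ν => if ν = μ then 1 else 0)
  set P := op c (fun ν => if ν = μ then 1 else 0) with hP
  have hPX : X * P = P * X := by
    ext v
    exact op_comm hs hs X (fun v => LinearMap.congr_fun hX v) _ v
  have hne : c.maxGenEigenspace μ ≠ ⊥ := by
    intro h
    have h1 := Module.End.eigenspace_le_maxGenEigenspace (f := c) (μ := μ)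
    rw [h, le_bot_iff] at h1
    exact hμ h1
  have h0 : LinearMap.trace k V (P * c) = 0 := by
    have e : P * c = P * X * z - P * z * X := by rw [← hc]; noncomm_ring
    rw [e, map_sub, LinearMap.trace_mul_comm k (P * z) X, ← mul_assoc, hPX, sub_self]
  rw [h0] at htr
  have : ∑ ν ∈ F, (Module.finrank k (c.maxGenEigenspace ν) : k) * (if ν = μ then 1 else 0) * ν =
      (Module.finrank k (c.maxGenEigenspace μ) : k) * μ := by
    rw [Finset.sum_eq_single μ]
    · simp
    · intro b _ hb; simp [hb]
    · intro h; exact absurd ((hF μ).mpr hne) h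
  rw [this] at htr
  rcases mul_eq_zero.mp htr.symm with h | h
  · have h2 : Module.finrank k (c.maxGenEigenspace μ) = 0 := by exact_mod_cast h
    exact hne (Submodule.finrank_eq_zero.mp h2)
  · exact hμ0 h

theorem trace_Xz {V : Type*} [AddCommGroup V] [Module k V] [FiniteDimensional k V]
    (X z c : Module.End k V) (hc : X * z - z * X = c) (hX : X * c = c * X) (hn : IsNilpotent X) :
    LinearMap.trace k V (X * z) = 0 := by
  refine (LinearMap.isNilpotent_trace_of_isNilpotent (nilp_of_eig _ fun μ hμ => ?_)).eq_zero
  obtain ⟨w, hw, hw0⟩ := hμ.exists_hasEigenvector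
  rw [Module.End.mem_eigenspace_iff] at hw
  have hex : ∃ j : ℕ, (X ^ j) w = 0 := by
    obtain ⟨N, hN⟩ := hn
    exact ⟨N, by rw [hN]; rfl⟩
  classical
  have hj := Nat.find_spec hex
  have hjm : ∀ i < Nat.find hex, (X ^ i) w ≠ 0 := fun i hi => Nat.find_min hex hi
  generalize Nat.find hex = j at hj hjm
  rcases j with _ | j
  · exact absurd (by simpa using hj) hw0
  have hcomm : ∀ m : ℕ, X ^ (m + 1) * z = z * X ^ (m + 1) + ((m + 1 : ℕ) : k) • (c * X ^ m) := by
    intro m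
    have hXz : X * z = z * X + c := by rw [← hc]; abel
    induction m with
    | zero => simp [hXz]
    | succ m ih =>
      calc X ^ (m + 1 + 1) * z = X * (X ^ (m + 1) * z) := by rw [pow_succ' X (m + 1), mul_assoc]
        _ = (X * z) * X ^ (m + 1) + ((m + 1 : ℕ) : k) • ((X * c) * X ^ m) := by
          rw [ih, mul_add, mul_smul_comm, mul_assoc, mul_assoc]
        _ = z * X ^ (m + 1 + 1) + c * X ^ (m + 1) + ((m + 1 : ℕ) : k) • (c * X ^ (m + 1)) := by
          rw [hXz, hX, add_mul, mul_assoc, mul_assoc, ← pow_succ', ← pow_succ']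
        _ = _ := by
          push_cast
          rw [add_smul ((m : k) + 1), one_smul]
          abel
  have h1 := LinearMap.congr_fun (hcomm j) w
  rw [LinearMap.add_apply, Module.End.mul_apply, Module.End.mul_apply, hj, map_zero, zero_add,
    pow_succ, Module.End.mul_apply, ← Module.End.mul_apply X z, hw, map_smul, LinearMap.smul_apply,
    Module.End.mul_apply] at h1
  have hj0 : ((j + 1 : ℕ) : k) ≠ 0 := by exact_mod_cast j.succ_ne_zero
  have h2 : c ((X ^ j) w) = (((j + 1 : ℕ) : k)⁻¹ * μ) • (X ^ j) w := by
    rw [← smul_smul, h1, smul_smul, inv_mul_cancel₀ hj0, one_smul]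
  obtain ⟨N, hN⟩ := jacobson X z c hc hX
  have h3 : ∀ m : ℕ, (c ^ m) ((X ^ j) w) = (((j + 1 : ℕ) : k)⁻¹ * μ) ^ m • (X ^ j) w := by
    intro m
    induction m with
    | zero => simp
    | succ m ih => rw [pow_succ, Module.End.mul_apply, h2, map_smul, ih, smul_smul, ← pow_succ']
  have h4 := h3 N
  rw [hN, LinearMap.zero_apply] at h4
  rcases smul_eq_zero.mp h4.symm with h | h
  · have := eq_zero_of_pow_eq_zero h
    rcases mul_eq_zero.mp this with h | h
    · exact absurd (inv_eq_zero.mp h) hj0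
    · exact h
  · exact absurd h (hjm j (Nat.lt_succ_self j))

theorem trace_Xz_mat {n : ℕ} (X z c : Matrix (Fin n) (Fin n) k) (hc : X * z - z * X = c)
    (hX : X * c = c * X) (hn : IsNilpotent X) : (X * z).trace = 0 := by
  have h := trace_Xz (TL X) (TL z) (TL c) (by
      rw [← hc]; simp [TL, Matrix.toLin'_mul, Module.End.mul_eq_comp]) (by
      have := congrArg TL hX
      simpa [TL, Matrix.toLin'_mul, Module.End.mul_eq_comp] using this)
    ((Matrix.isNilpotent_toLin'_iff X).mpr hn)
  rw [Module.End.mul_eq_comp, ← Matrix.toLin'_mul, Matrix.trace_toLin'_eq] at h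
  exact h

theorem jm {n : ℕ} (g : Submodule k (Matrix (Fin n) (Fin n) k))
    (hlie : ∀ a ∈ g, ∀ b ∈ g, a * b - b * a ∈ g)
    (hnd : ∀ a ∈ g, (∀ b ∈ g, (a * b).trace = 0) → a = 0)
    (X : Matrix (Fin n) (Fin n) k) (hX : X ∈ g) (hn : IsNilpotent X) :
    ∃ Y ∈ g, (X * Y - Y * X) * X - X * (X * Y - Y * X) = (2 : k) • X := by
  let ad : Matrix (Fin n) (Fin n) k →ₗ[k] Matrix (Fin n) (Fin n) k :=
    LinearMap.mulLeft k X - LinearMap.mulRight k X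
  have had : ∀ a, ad a = X * a - a * X := fun a => rfl
  have hadg : ∀ a ∈ g, ad a ∈ g := fun a ha => hlie X hX a ha
  let B : g →ₗ[k] Module.Dual k g := LinearMap.mk₂ k (fun a b => ((a : Matrix (Fin n) (Fin n) k) * (b : Matrix (Fin n) (Fin n) k)).trace)
    (by intros; simp [add_mul]) (by intros; simp) (by intros; simp [mul_add]) (by intros; simp)
  have hB : ∀ a b : g, B a b = ((a : Matrix (Fin n) (Fin n) k) * (b : Matrix (Fin n) (Fin n) k)).trace := fun a b => rfl
  have hBinj : Function.Injective B := by
    rw [injective_iff_map_eq_zero]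
    intro a ha
    apply Subtype.ext
    refine hnd a a.2 fun b hb => ?_
    rw [← hB a ⟨b, hb⟩, ha]; rfl
  have hBsurj : Function.Surjective B :=
    (LinearMap.injective_iff_surjective_of_finrank_eq_finrank (Subspace.dual_finrank_eq).symm).mp hBinj
  let R : Submodule k g := LinearMap.range ((ad.restrict hadg) ∘ₗ (ad.restrict hadg))
  have hmem : (⟨X, hX⟩ : g) ∈ R := by
    by_contra hno
    obtain ⟨f, hf, hfR⟩ := Submodule.exists_le_ker_of_notMem hno
    obtain ⟨z, rfl⟩ := hBsurj f
    apply hf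
    rw [hB]
    have h1 : ad (ad (z : Matrix (Fin n) (Fin n) k)) = 0 := by
      refine hnd _ (hadg _ (hadg _ z.2)) fun b hb => ?_
      have h2 : B z ((ad.restrict hadg) ((ad.restrict hadg) ⟨b, hb⟩)) = 0 := hfR ⟨⟨b, hb⟩, rfl⟩
      rw [hB] at h2
      have h3 : ((z : Matrix (Fin n) (Fin n) k) * ad (ad b)).trace = 0 := h2
      rw [← h3]
      have key : ∀ p q : Matrix (Fin n) (Fin n) k, (ad p * q).trace = - (p * ad q).trace := by
        intro p q
        rw [had, had, sub_mul, mul_sub, Matrix.trace_sub, Matrix.trace_sub, Matrix.mul_assoc X,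
          Matrix.trace_mul_comm X, Matrix.mul_assoc, Matrix.mul_assoc]
        ring
      rw [key, key, neg_neg]
    rw [Matrix.trace_mul_comm]
    refine trace_Xz_mat X z (ad z) rfl ?_ hn
    rw [had (ad (z : Matrix (Fin n) (Fin n) k))] at h1
    exact sub_eq_zero.mp h1
  obtain ⟨y, hy⟩ := hmem
  have hy' : ad (ad (y : Matrix (Fin n) (Fin n) k)) = X := congrArg Subtype.val hy
  refine ⟨(-2 : k) • y, g.smul_mem _ y.2, ?_⟩
  rw [had, had] at hy'
  rw [mul_smul_comm, smul_mul_assoc, ← smul_sub, mul_smul_comm, smul_mul_assoc, ← smul_sub]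
  conv_rhs => rw [← hy']
  rw [neg_smul, ← smul_neg, neg_sub]

end jm


section sltwo
variable {k : Type} [Field k]

theorem aeval_intertw {M N : Type*} [AddCommGroup M] [Module k M] [AddCommGroup N] [Module k N]
    {T : Module.End k M} {S : Module.End k N} (f : M →ₗ[k] N) (hf : ∀ x, f (T x) = S (f x))
    (q : Polynomial k) (x : M) : f (Polynomial.aeval T q x) = Polynomial.aeval S q (f x) := by
  induction q using Polynomial.induction_on' with
  | add q r hq hr => simp [hq, hr]
  | monomial n a =>
    have h : ∀ (m : ℕ) (y : M), f ((T ^ m) y) = (S ^ m) (f y) := by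
      intro m
      induction m with
      | zero => intro y; simp
      | succ m ih => intro y; rw [pow_succ, pow_succ, Module.End.mul_apply, Module.End.mul_apply, ih, hf]
    simp [Polynomial.aeval_monomial, h]

/-- The polynomial with roots `0, …, N-1`. -/
noncomputable def QQ (k : Type) [Field k] (N : ℕ) : Polynomial k :=
  ∏ j ∈ Finset.range N, (Polynomial.X - Polynomial.C (j : k))

theorem sl2_abs [CharZero k] {M : Type*} [AddCommGroup M] [Module k M] (X Y h : Module.End k M)
    (hXY : X * Y - Y * X = h) (hhX : h * X - X * h = (2 : k) • X) {F : M} (hF : X F = 0) (N : ℕ)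
    (hN : (X ^ N) ((Y ^ N) F) = 0) : Polynomial.aeval h (QQ k N) F = 0 := by
  have hker : ∀ q : Polynomial k, X (Polynomial.aeval h q F) = 0 := by
    intro q
    have := aeval_stable (T := h) (p := LinearMap.ker X) (by
      intro x hx
      rw [LinearMap.mem_ker] at *
      have := LinearMap.congr_fun hhX x
      simp only [LinearMap.sub_apply, Module.End.mul_apply, LinearMap.smul_apply, hx, map_zero,
        smul_zero, zero_sub, neg_eq_zero] at this
      exact this) q F hF
    exact this
  have hhp : ∀ i : ℕ, X ^ i * h = (h - ((2 * i : ℕ) : k) • 1) * X ^ i := by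
    intro i
    have e : X * h = h * X - (2 : k) • X := by rw [← hhX]; abel
    induction i with
    | zero => simp
    | succ i ih =>
      rw [pow_succ', mul_assoc, ih, ← mul_assoc, mul_sub, e]
      rw [← mul_assoc]
      congr 1
      rw [mul_smul_comm, mul_one, sub_mul, smul_mul_assoc, one_mul]
      push_cast
      rw [mul_add, mul_one, add_smul]
      abel
  have hcomm : ∀ j : ℕ, X ^ (j + 1) * Y - Y * X ^ (j + 1) =
      ((j + 1 : ℕ) : k) • ((h - (j : k) • 1) * X ^ j) := by
    intro j
    have e : X * Y = Y * X + h := by rw [← hXY]; abel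
    have e2 : X * h = h * X - (2 : k) • X := by rw [← hhX]; abel
    induction j with
    | zero => simp [hXY]
    | succ j ih =>
      have ih' : X ^ (j + 1) * Y = Y * X ^ (j + 1) + ((j + 1 : ℕ) : k) • ((h - (j : k) • 1) * X ^ j) := by
        rw [← ih]; abel
      calc X ^ (j + 1 + 1) * Y - Y * X ^ (j + 1 + 1)
          = X ^ (j + 1) * (X * Y) - Y * X ^ (j + 1 + 1) := by rw [pow_succ X (j + 1), mul_assoc]
        _ = (X ^ (j + 1) * Y) * X + X ^ (j + 1) * h - Y * X ^ (j + 1 + 1) := by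
            rw [e, mul_add, mul_assoc]
        _ = ((j + 1 : ℕ) : k) • ((h - (j : k) • 1) * X ^ (j + 1)) +
              (h - ((2 * (j + 1) : ℕ) : k) • 1) * X ^ (j + 1) := by
            rw [ih', hhp, add_mul, smul_mul_assoc, mul_assoc, mul_assoc, ← pow_succ, ← pow_succ]
            abel
        _ = _ := by
            rw [← smul_mul_assoc, ← add_mul, ← smul_mul_assoc]
            congr 1
            push_cast
            module
  have key : ∀ m : ℕ, (X ^ m) ((Y ^ m) F) = ((m.factorial : ℕ) : k) • Polynomial.aeval h (QQ k m) F := by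
    intro m
    induction m with
    | zero => simp [QQ]
    | succ m ih =>
      have h1 := LinearMap.congr_fun (hcomm m) ((Y ^ m) F)
      rw [LinearMap.sub_apply, Module.End.mul_apply, Module.End.mul_apply, pow_succ' X m,
        Module.End.mul_apply X (X ^ m) ((Y ^ m) F), ih, map_smul, hker, smul_zero, map_zero, sub_zero,
        LinearMap.smul_apply, Module.End.mul_apply _ (X ^ m) ((Y ^ m) F), ih, map_smul, smul_smul] at h1
      rw [pow_succ' Y, Module.End.mul_apply Y, pow_succ' X, h1, Nat.factorial_succ]
      push_cast
      congr 1
      rw [QQ, QQ, Finset.prod_range_succ, mul_comm, map_mul, Module.End.mul_apply]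
      congr 1
      simp [Algebra.algebraMap_eq_smul_one]
      rw [Nat.cast_smul_eq_nsmul, nsmul_one]
  have h1 := key N
  rw [hN] at h1
  rcases smul_eq_zero.mp h1.symm with h | h
  · exact absurd h (by exact_mod_cast N.factorial_ne_zero)
  · exact h

theorem sl2_mod [CharZero k] {M : Type*} [AddCommGroup M] [Module k M] (p : Submodule k M)
    (X Y h : Module.End k M) (hX : ∀ v ∈ p, X v ∈ p) (hY : ∀ v ∈ p, Y v ∈ p) (hh : ∀ v ∈ p, h v ∈ p)
    (hXY : X * Y - Y * X = h) (hhX : h * X - X * h = (2 : k) • X) {F : M} (hF : X F ∈ p) (N : ℕ)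
    (hN : (X ^ N) ((Y ^ N) F) = 0) : Polynomial.aeval h (QQ k N) F ∈ p := by
  have e : ∀ (T S : Module.End k M) (hT : p ≤ p.comap T) (hS : p ≤ p.comap S) ,
      p.mapQ p (T * S) (fun v hv => hT (hS hv)) = p.mapQ p T hT * p.mapQ p S hS := by
    intro T S hT hS
    ext v; rfl
  have h1 := sl2_abs (p.mapQ p X hX) (p.mapQ p Y hY) (p.mapQ p h hh) (F := p.mkQ F) (by
      ext v
      have := congrArg p.mkQ (LinearMap.congr_fun hXY v)
      exact this) (by
      ext v
      have := congrArg p.mkQ (LinearMap.congr_fun hhX v)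
      exact this) (by
      have : p.mkQ (X F) = 0 := by simpa using hF
      exact this) N (by
      have h2 : ∀ (T : Module.End k M) (hT : p ≤ p.comap T) (m : ℕ) (v : M),
          ((p.mapQ p T hT) ^ m) (p.mkQ v) = p.mkQ ((T ^ m) v) := by
        intro T hT m
        induction m with
        | zero => intro v; rfl
        | succ m ih =>
          intro v
          rw [pow_succ, pow_succ, Module.End.mul_apply, Module.End.mul_apply, ← ih]; rfl
      rw [h2, h2, hN, map_zero])
  rw [← aeval_intertw p.mkQ (T := h) (fun v => rfl)] at h1
  simpa using h1

end sltwo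

section fin
variable {k : Type} [Field k] {n : ℕ}

/-- Affine linear forms. -/
noncomputable def Vlin (n : ℕ) (k : Type) [Field k] : Submodule k (PR n k) :=
  Submodule.span k (insert 1 (Set.range MvPolynomial.X))

theorem DD_Vlin (a : Matrix (Fin n) (Fin n) k) {f : PR n k} (hf : f ∈ Vlin n k) :
    DD a f ∈ Vlin n k := by
  have hX : ∀ i, (MvPolynomial.X i : PR n k) ∈ Vlin n k :=
    fun i => Submodule.subset_span (Or.inr ⟨i, rfl⟩)
  induction hf using Submodule.span_induction with
  | mem f hf =>
    rcases hf with rfl | ⟨⟨i, j⟩ | u, rfl⟩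
    · rw [Derivation.map_one_eq_zero]; exact Submodule.zero_mem _
    · rw [DD_inl]
      refine Submodule.sum_mem _ fun l _ => ?_
      rw [MvPolynomial.C_mul']
      exact Submodule.smul_mem _ _ (hX _)
    · rw [DD_inr, MvPolynomial.C_mul']
      exact Submodule.smul_mem _ _ (hX _)
  | zero => rw [map_zero]; exact Submodule.zero_mem _
  | add f g _ _ hf hg => rw [map_add]; exact Submodule.add_mem _ hf hg
  | smul c f _ hf => rw [Derivation.map_smul]; exact Submodule.smul_mem _ _ hf

theorem DD_Vpow (a : Matrix (Fin n) (Fin n) k) (d : ℕ) {f : PR n k} (hf : f ∈ Vlin n k ^ d) :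
    DD a f ∈ Vlin n k ^ d := by
  induction hf using Submodule.pow_induction_on_left' with
  | algebraMap r => rw [Derivation.map_algebraMap]; exact Submodule.zero_mem _
  | add x y i _ _ hx hy => rw [map_add]; exact Submodule.add_mem _ hx hy
  | mem_mul v hv i x hx hx' =>
    rw [Derivation.leibniz, smul_eq_mul, smul_eq_mul, pow_succ']
    refine Submodule.add_mem _ (Submodule.mul_mem_mul hv hx') ?_
    rw [mul_comm x]
    exact Submodule.mul_mem_mul (DD_Vlin a hv) hx

theorem exists_Vpow (f : PR n k) : ∃ d : ℕ, f ∈ Vlin n k ^ d := by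
  have h1 : (1 : PR n k) ∈ Vlin n k := Submodule.subset_span (Or.inl rfl)
  have hmono : ∀ d e : ℕ, d ≤ e → Vlin n k ^ d ≤ Vlin n k ^ e := by
    intro d e h
    exact pow_le_pow_right₀ (Submodule.one_le.mpr h1) h
  induction f using MvPolynomial.induction_on with
  | C a => exact ⟨0, by rw [pow_zero]; exact ⟨a, by simp [MvPolynomial.smul_eq_C_mul]⟩⟩
  | add p q hp hq =>
    obtain ⟨d, hd⟩ := hp
    obtain ⟨e, he⟩ := hq
    exact ⟨max d e, Submodule.add_mem _ (hmono _ _ (le_max_left _ _) hd) (hmono _ _ (le_max_right _ _) he)⟩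
  | mul_X p i hp =>
    obtain ⟨d, hd⟩ := hp
    exact ⟨d + 1, by rw [pow_succ]; exact Submodule.mul_mem_mul hd (Submodule.subset_span (Or.inr ⟨i, rfl⟩))⟩

theorem fin_Vpow (d : ℕ) : Module.Finite k (Vlin n k ^ d : Submodule k (PR n k)) := by
  refine Module.Finite.iff_fg.mpr (Submodule.FG.pow ?_ d)
  exact Submodule.fg_span ((Set.finite_range _).insert _)

theorem DD_nilp [IsAlgClosed k] [CharZero k] {X : Matrix (Fin n) (Fin n) k} (hX : IsNilpotent X)
    (Y : Matrix (Fin n) (Fin n) k) (f : PR n k) :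
    ∃ N : ℕ, ((DD X : PR n k →ₗ[k] PR n k) ^ N) (((DD Y : PR n k →ₗ[k] PR n k) ^ N) f) = 0 := by
  obtain ⟨d, hd⟩ := exists_Vpow f
  have hW : Wt X (⊥ : AddSubgroup k) := by
    refine ⟨fun μ hμ => ?_, ?_⟩
    · have hn : IsNilpotent (TL X) := (Matrix.isNilpotent_toLin'_iff X).mpr hX
      obtain ⟨N, hN⟩ := hn
      obtain ⟨v, hv⟩ := hμ.exists_hasEigenvector
      have := hv.pow_apply N
      rw [hN, LinearMap.zero_apply] at this
      rcases smul_eq_zero.mp this.symm with h | h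
      · exact eq_zero_of_pow_eq_zero h
      · exact absurd h hv.2
    · exact (Matrix.isNilpotent_trace_of_isNilpotent hX).eq_zero
  have hloc : ∀ f : PR n k, ∃ m : ℕ, ((DD X : PR n k →ₗ[k] PR n k) ^ m) f = 0 := by
    intro f
    have hf : f ∈ Module.End.maxGenEigenspace (DD X : PR n k →ₗ[k] PR n k) 0 := by
      induction f using spansIn_induction (spansIn_DD hW) with
      | h1 μ hμ x hx =>
        have : μ = 0 := hμ
        rwa [this] at hx
      | h2 x y hx hy => exact Submodule.add_mem _ hx hy
    rw [Module.End.mem_maxGenEigenspace] at hf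
    simpa using hf
  have := fin_Vpow (n := n) (k := k) d
  set T := (DD X : PR n k →ₗ[k] PR n k).restrict (p := Vlin n k ^ d) (q := Vlin n k ^ d)
    (fun f hf => DD_Vpow X d hf) with hT
  have hTp : ∀ (m : ℕ) (v : (Vlin n k ^ d : Submodule k (PR n k))), ((T ^ m) v : PR n k) =
      ((DD X : PR n k →ₗ[k] PR n k) ^ m) v := by
    intro m
    induction m with
    | zero => intro v; rfl
    | succ m ih => intro v; rw [pow_succ, pow_succ, Module.End.mul_apply, Module.End.mul_apply, ih]; rfl
  have hTn : IsNilpotent T := by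
    rw [Module.End.isNilpotent_iff_of_finite]
    intro v
    obtain ⟨m, hm⟩ := hloc v
    exact ⟨m, Subtype.ext (by rw [hTp, hm]; rfl)⟩
  obtain ⟨N, hN⟩ := hTn
  have hYN : ∀ m : ℕ, ((DD Y : PR n k →ₗ[k] PR n k) ^ m) f ∈ Vlin n k ^ d := by
    intro m
    induction m with
    | zero => simpa using hd
    | succ m ih => rw [pow_succ', Module.End.mul_apply]; exact DD_Vpow Y d ih
  refine ⟨N, ?_⟩
  have := hTp N ⟨_, hYN N⟩
  rw [hN] at this
  exact this.symm

end fin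


section mainpart
variable {k : Type} [Field k]

theorem exists_orbit_fun {G : AlgGroup k} {m : ℕ} (X : GVariety G m) {x : Fin m → k}
    (hx : x ∈ X.carrier) : ∃ F : Fin m → PR G.n k, ∀ g ∈ G.toSubgroup, ∀ i, ev g (F i) = X.act g x i := by
  obtain ⟨p, hp⟩ := X.regular
  let φ : MvPolynomial ((Fin G.n × Fin G.n) ⊕ (Unit ⊕ Fin m)) k →ₐ[k] PR G.n k :=
    MvPolynomial.aeval (Sum.elim (fun ij => MvPolynomial.X (Sum.inl ij))
      (Sum.elim (fun _ => MvPolynomial.X (Sum.inr ())) (fun j => MvPolynomial.C (x j))))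
  refine ⟨fun i => φ (p i), fun g hg i => ?_⟩
  rw [hp g hg x hx i]
  have : (ev g).comp φ = MvPolynomial.aeval (Sum.elim (mat2pt (g : Matrix (Fin G.n) (Fin G.n) k))
            (Sum.elim
              (fun _ => ((g⁻¹ : GL (Fin G.n) k) : Matrix (Fin G.n) (Fin G.n) k).det)
              x)) := by
    ext v
    rcases v with ⟨i, j⟩ | u | j
    · simp [φ, mat2pt]
    · simp [φ]
    · simp [φ]
  have := DFunLike.congr_fun this (p i)
  simpa [MvPolynomial.aeval_eq_eval] using this

/-- The stabilizer as a subgroup. -/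
def stabG {G : AlgGroup k} {m : ℕ} (X : GVariety G m) {x : Fin m → k} (hx : x ∈ X.carrier) :
    Subgroup (GL (Fin G.n) k) where
  carrier := stabSet X x
  one_mem' := ⟨G.toSubgroup.one_mem, X.act_one x hx⟩
  mul_mem' := by
    rintro a b ⟨ha, ha'⟩ ⟨hb, hb'⟩
    exact ⟨G.toSubgroup.mul_mem ha hb, by rw [X.act_mul a ha b hb x hx, hb', ha']⟩
  inv_mem' := by
    rintro a ⟨ha, ha'⟩
    refine ⟨G.toSubgroup.inv_mem ha, ?_⟩
    have := X.act_mul _ (G.toSubgroup.inv_mem ha) a ha x hx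
    rw [inv_mul_cancel, X.act_one x hx, ha'] at this
    exact this.symm

theorem stabG_Cl {G : AlgGroup k} {m : ℕ} (X : GVariety G m) {x : Fin m → k} (hx : x ∈ X.carrier) :
    Cl (stabG X hx) := by
  intro g hg
  obtain ⟨F, hF⟩ := exists_orbit_fun X hx
  have hgG : g ∈ G.toSubgroup :=
    Cl_of_AlgGroup G g fun f hf => hg f fun u hu => hf u hu.1
  refine ⟨hgG, ?_⟩
  funext i
  have := hg (F i - MvPolynomial.C (x i)) (by
    intro u hu
    rw [map_sub, ev_C, hF u hu.1, hu.2, sub_self])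
  rw [map_sub, ev_C, hF g hgG, sub_eq_zero] at this
  exact this

theorem onePS_nontriv [CharZero k] {G : AlgGroup k} {m : ℕ} (X : GVariety G m)
    (hGX : (actionCenter X).Finite) (lam : OnePS G) {w : Fin G.n → k} (hw : w ≠ 0) {e : ℤ}
    (he : e ≠ 0) (hlam : ∀ t, (lam.toFun t : Matrix (Fin G.n) (Fin G.n) k).mulVec w =
      ((t ^ e : kˣ) : k) • w) : ¬ (∀ t : kˣ, lam.toFun t ∈ actionCenter X) := by
  intro h
  let u : kˣ := Units.mk0 (2 : k) two_ne_zero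
  have hinj : Function.Injective (fun j : ℕ => lam.toFun (u ^ j)) := by
    intro i j hij
    have h1 : lam.toFun (u ^ i) = lam.toFun (u ^ j) := hij
    have h2 := hlam (u ^ i)
    rw [h1, hlam (u ^ j)] at h2
    have h3 := smul_left_injective k hw h2
    simp only [Units.val_zpow_eq_zpow_val, Units.val_pow_eq_pow_val, u, Units.val_mk0] at h3
    rw [← zpow_natCast, ← zpow_natCast, ← zpow_mul, ← zpow_mul] at h3
    have h4 : ((2 : ℚ) ^ ((j : ℤ) * e)) = (2 : ℚ) ^ ((i : ℤ) * e) := by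
      have : (((2 : ℚ) ^ ((j : ℤ) * e) : ℚ) : k) = (((2 : ℚ) ^ ((i : ℤ) * e) : ℚ) : k) := by
        push_cast; exact h3
      exact_mod_cast this
    have h5 := zpow_right_injective₀ (by norm_num : (0 : ℚ) < 2) (by norm_num) h4
    have h6 := mul_right_cancel₀ he h5
    exact_mod_cast h6.symm
  exact Set.infinite_range_of_injective hinj
    (hGX.subset (by rintro _ ⟨j, rfl⟩; exact h _))

theorem limit_of_poly [CharZero k] {G : AlgGroup k} {m : ℕ} (X : GVariety G m) {x : Fin m → k}
    (hx : x ∈ X.carrier) (lam : OnePS G) (q : Fin m → Polynomial k)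
    (hq : ∀ (t : kˣ) (i : Fin m), X.act (lam.toFun t) x i = (q i).eval (t : k)) :
    InLambda X x lam := by
  refine ⟨fun i => (q i).eval 0, ?_, q, hq, fun i => rfl⟩
  obtain ⟨I, hI⟩ := X.closed
  rw [hI]
  intro f hf
  let P : Polynomial k := MvPolynomial.aeval q f
  have hP : ∀ s : k, P.eval s = MvPolynomial.eval (fun i => (q i).eval s) f := by
    intro s
    have : (Polynomial.aeval s).comp (MvPolynomial.aeval q) =
        (MvPolynomial.aeval (fun i => (q i).eval s) : MvPolynomial (Fin m) k →ₐ[k] k) := by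
      ext i; simp [Polynomial.coe_aeval_eq_eval]
    have := DFunLike.congr_fun this f
    simpa [P, Polynomial.coe_aeval_eq_eval, MvPolynomial.aeval_eq_eval] using this
  have hP0 : Polynomial.X * P = 0 := by
    apply Polynomial.funext
    intro s
    rw [Polynomial.eval_mul, Polynomial.eval_X, Polynomial.eval_zero]
    by_cases hs : s = 0
    · rw [hs, zero_mul]
    · have h1 := X.act_mem _ (lam.mem (Units.mk0 s hs)) x hx
      rw [hI] at h1
      have h2 := h1 f hf
      rw [show X.act (lam.toFun (Units.mk0 s hs)) x = fun i => (q i).eval s from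
        funext fun i => hq _ i] at h2
      rw [hP, h2, mul_zero]
  have hP1 : P = 0 := (mul_eq_zero.mp hP0).resolve_left Polynomial.X_ne_zero
  rw [← hP, hP1, Polynomial.eval_zero]

variable [IsAlgClosed k] [CharZero k]

theorem nilp_of_onePSStable {G : AlgGroup k} {m : ℕ} (X : GVariety G m)
    (hGX : (actionCenter X).Finite) {x : Fin m → k} (hx : x ∈ X.carrier) (hs : OnePSStable X x)
    {a : Matrix (Fin G.n) (Fin G.n) k} (ha : a ∈ LieH (stabG X hx)) : IsNilpotent a := by
  by_contra hn
  have : ∃ μ, (TL a).HasEigenvalue μ ∧ μ ≠ 0 := by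
    by_contra! hc
    exact hn ((Matrix.isNilpotent_toLin'_iff a).mp (nilp_of_eig (TL a) hc))
  obtain ⟨μ, hμ, hμ0⟩ := this
  obtain ⟨S, hS, hW, -⟩ := exists_Wt a 0
  obtain ⟨z, hz, hzμ⟩ := exists_z S hS μ (hW.1 μ hμ) hμ0
  obtain ⟨lam, h1, -, h3⟩ := replica_onePS G hW (H := stabG X hx) (fun u hu => hu.1)
    (stabG_Cl X hx) ha z hz
  obtain ⟨w, hw⟩ := hμ.exists_hasEigenvector
  refine hs.2 lam (onePS_nontriv X hGX lam hw.2 hzμ fun t =>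
    h3 t μ w (Module.End.eigenspace_le_maxGenEigenspace hw.1)) ?_
  refine limit_of_poly X hx lam (fun i => Polynomial.C (x i)) fun t i => ?_
  rw [(h1 t).2, Polynomial.eval_C]

theorem DD_orbit {G : AlgGroup k} {m : ℕ} (X : GVariety G m) {x : Fin m → k} (hx : x ∈ X.carrier)
    {a : Matrix (Fin G.n) (Fin G.n) k} (ha : a ∈ LieH (stabG X hx)) {i : Fin m} {F : PR G.n k}
    (hF : ∀ g ∈ G.toSubgroup, ev g F = X.act g x i) : DD a F ∈ JJ G.toSubgroup := by
  intro g hg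
  have h1 : LT g F - MvPolynomial.C (ev g F) ∈ JJ (stabG X hx) := by
    intro u hu
    rw [map_sub, ev_C, ev_LT, hF _ (G.toSubgroup.mul_mem hg hu.1), hF g hg,
      X.act_mul g hg u hu.1 x hx, hu.2, sub_self]
  have h2 := ha _ h1 1 (Subgroup.one_mem _)
  rw [map_sub, MvPolynomial.derivation_C, sub_zero, DD_LT, ev_LT, mul_one] at h2
  exact h2

theorem stab_finite (G : AlgGroup k) (hG : IsReductive G) {m : ℕ} (X : GVariety G m)
    (hGX : (actionCenter X).Finite) {x : Fin m → k} (hx : x ∈ X.carrier) (hs : OnePSStable X x) :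
    (stabSet X x).Finite := by
  by_contra hinf
  obtain ⟨a, ha, ha0⟩ := exists_lie_ne_zero (H := stabG X hx) hinf
  have hle : stabG X hx ≤ G.toSubgroup := fun u hu => hu.1
  have hn := nilp_of_onePSStable X hGX hx hs ha
  have haG : a ∈ LieH G.toSubgroup := LieH_mono hle ha
  obtain ⟨y, hy, hjm⟩ := jm (LieH G.toSubgroup) (fun a ha b hb => LieH_lie ha hb)
    (fun a ha h => trace_nondeg G hG ha h) a haG hn
  set h := a * y - y * a with hh
  have hhG : h ∈ LieH G.toSubgroup := LieH_lie haG hy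
  obtain ⟨F, hF⟩ := exists_orbit_fun X hx
  let J : Submodule k (PR G.n k) := (JJ G.toSubgroup).restrictScalars k
  have hQ : ∀ i, ∃ N : ℕ, Polynomial.aeval (DD h : PR G.n k →ₗ[k] PR G.n k) (QQ k N) (F i) ∈ J := by
    intro i
    obtain ⟨N, hN⟩ := DD_nilp hn y (F i)
    refine ⟨N, sl2_mod J (DD a : PR G.n k →ₗ[k] PR G.n k) (DD y : PR G.n k →ₗ[k] PR G.n k) _
      (fun v hv => haG v hv) (fun v hv => hy v hv) (fun v hv => hhG v hv) ?_ ?_ ?_ N hN⟩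
    · apply LinearMap.ext
      intro v
      exact (DD_lie_apply a y v).symm
    · apply LinearMap.ext
      intro v
      have := DD_lie_apply h a v
      rw [hjm, DD_smul] at this
      exact this.symm
    · exact DD_orbit X hx ha (fun g hg => hF g hg i)
  -- the one-parameter subgroup
  obtain ⟨S, hS, hW, h1L⟩ := exists_Wt h (1 : k)
  set L := AddSubgroup.closure S with hL
  have hz : ∃ z : k → ℤ, (∀ a ∈ L, ∀ b ∈ L, z (a + b) = z a + z b) ∧ 0 < z 1 := by
    obtain ⟨z, hz, hz1⟩ := exists_z S hS 1 h1L one_ne_zero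
    rcases lt_or_gt_of_ne hz1 with h | h
    · refine ⟨fun a => - z a, fun a ha b hb => ?_, by simpa using h⟩
      show - z (a + b) = - z a + - z b
      rw [hz a ha b hb]; ring
    · exact ⟨z, hz, h⟩
  obtain ⟨z, hz, hz1⟩ := hz
  have hjL : ∀ j : ℕ, (j : k) ∈ L := by
    intro j
    have := L.nsmul_mem h1L j
    simpa using this
  have hzj : ∀ j : ℕ, z (j : k) = j * z 1 := by
    intro j
    induction j with
    | zero =>
      have := hz 0 L.zero_mem 0 L.zero_mem
      rw [add_zero] at this
      push_cast
      linarith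
    | succ j ih => push_cast; rw [hz _ (hjL j) _ h1L, ih]; ring
  obtain ⟨lam, -, h2, h3⟩ := replica_onePS G hW le_rfl (Cl_of_AlgGroup G) hhG z hz
  have hsp : Spans (DD h : PR G.n k →ₗ[k] PR G.n k) := (spansIn_DD hW).spans
  have hJst : ∀ v ∈ J, (DD h : PR G.n k →ₗ[k] PR G.n k) v ∈ J := fun v hv => hhG v hv
  -- nontriviality
  have hnt : ∃ μ, ∃ w ∈ (TL h).maxGenEigenspace μ, w ≠ 0 ∧ z μ ≠ 0 := by
    by_contra! hcon
    apply ha0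
    apply Matrix.toLin'.injective
    rw [map_zero]
    apply LinearMap.ext
    intro w
    rw [LinearMap.zero_apply]
    induction w using spans_induction (spans_lin h) with
    | h2 v w hv hw => rw [map_add, hv, hw, add_zero]
    | h1 μ w hw =>
      by_contra hne
      have hw0 : w ≠ 0 := by rintro rfl; exact hne (map_zero _)
      have hcommE : ∀ v, TL a (TL h v) = (TL h - (2 : k) • (1 : Module.End k (Fin G.n → k)) : Module.End k (Fin G.n → k)) (TL a v) := by
        intro v
        have e : a * h = h * a - (2 : k) • a := by rw [← hjm]; abel
        have e2 := congrArg (fun M => Matrix.mulVec M v) e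
        simp only [Matrix.sub_mulVec, Matrix.smul_mulVec, ← Matrix.mulVec_mulVec] at e2
        simpa [TL] using e2
      have h4 := map_maxGen (TL a) hcommE hw
      have h5 : TL a w ∈ (TL h).maxGenEigenspace (μ + 2) := by
        rw [Module.End.mem_maxGenEigenspace] at h4 ⊢
        have e : TL h - (2 : k) • (1 : Module.End k (Fin G.n → k)) - μ • 1 = TL h - (μ + 2) • 1 := by
          rw [add_smul]; abel
        rwa [e] at h4
      have hμ : μ ∈ L := hW.1 μ (hasEig fun hb => hw0 (by rw [hb] at hw; exact hw))
      have e1 := hcon μ w hw hw0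
      have e2 := hcon (μ + 2) _ h5 hne
      have h2L : (2 : k) ∈ L := by exact_mod_cast hjL 2
      have e3 := hzj 2
      push_cast at e3
      rw [hz μ hμ 2 h2L, e1, e3] at e2
      linarith
  obtain ⟨μ, w, hw, hw0, hzμ⟩ := hnt
  refine hs.2 lam (onePS_nontriv X hGX lam hw0 hzμ fun t => h3 t μ w hw) ?_
  have hpoly : ∀ i, ∃ q : Polynomial k, ∀ t : kˣ,
      ev 1 (op (DD h : PR G.n k →ₗ[k] PR G.n k) (fun μ => ((t ^ z μ : kˣ) : k)) (F i)) = q.eval (t : k) := by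
    intro i
    obtain ⟨N, hN⟩ := hQ i
    let p : Submodule k (PR G.n k) :=
      J.comap (Polynomial.aeval (DD h : PR G.n k →ₗ[k] PR G.n k) (QQ k N) : Module.End k (PR G.n k))
    refine inv_induction hsp (p := p) ?_ (P := fun f => ∃ q : Polynomial k, ∀ t : kˣ,
      ev 1 (op (DD h : PR G.n k →ₗ[k] PR G.n k) (fun μ => ((t ^ z μ : kˣ) : k)) f) = q.eval (t : k))
      ?_ ?_ (F i) hN
    · intro f hf
      have := aeval_intertw (T := (DD h : PR G.n k →ₗ[k] PR G.n k))
        (S := (DD h : PR G.n k →ₗ[k] PR G.n k)) (DD h : PR G.n k →ₗ[k] PR G.n k) (fun _ => rfl)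
        (QQ k N) f
      show Polynomial.aeval (DD h : PR G.n k →ₗ[k] PR G.n k) (QQ k N) _ ∈ J
      rw [← this]
      exact hJst _ hf
    · intro μ f hf hfp
      by_cases hr : (QQ k N).eval μ = 0
      · rw [QQ, Polynomial.eval_prod, Finset.prod_eq_zero_iff] at hr
        obtain ⟨j, -, hj⟩ := hr
        rw [Polynomial.eval_sub, Polynomial.eval_X, Polynomial.eval_C, sub_eq_zero] at hj
        refine ⟨Polynomial.C (ev 1 f) * Polynomial.X ^ (j * (z 1).toNat), fun t => ?_⟩
        rw [op_apply hsp _ hf, map_smul, hj, hzj]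
        have : ((j : ℤ) * z 1) = ((j * (z 1).toNat : ℕ) : ℤ) := by
          push_cast; rw [Int.toNat_of_nonneg hz1.le]
        rw [this, zpow_natCast]
        rw [Units.val_pow_eq_pow_val, smul_eq_mul, Polynomial.eval_mul, Polynomial.eval_C,
          Polynomial.eval_pow, Polynomial.eval_X, mul_comm]
      · have hfJ : f ∈ J := mem_of_not_root hJst hr hf hfp
        refine ⟨0, fun t => ?_⟩
        have := op_stable hsp hJst (fun μ => ((t ^ z μ : kˣ) : k)) f hfJ
        rw [Polynomial.eval_zero]
        exact this 1 (Subgroup.one_mem _)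
    · rintro f g ⟨q, hq⟩ ⟨r, hr⟩
      exact ⟨q + r, fun t => by rw [map_add, map_add, hq, hr, Polynomial.eval_add]⟩
  choose q hq using hpoly
  refine limit_of_poly X hx lam q fun t i => ?_
  rw [← hF _ (lam.mem t), h2, hq]

end mainpart


section easy
variable {k : Type} [Field k]

theorem stable_iff {G : AlgGroup k} {m : ℕ} (X : GVariety G m) (hGX : (actionCenter X).Finite)
    (x : Fin m → k) : Stable X x ↔ ProperlyStable X x := by
  refine ⟨fun h => ⟨h.1, ?_⟩, fun h => ⟨h.1, h.2.image _⟩⟩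
  have h1 : (1 : GL (Fin G.n) k) ∈ actionCenter X := ⟨G.toSubgroup.one_mem, fun y hy => X.act_one y hy⟩
  have hf : (⋃₀ ((fun g => (fun h => g * h) '' actionCenter X) '' stabSet X x)).Finite := by
    refine Set.Finite.sUnion h.2 ?_
    rintro _ ⟨g, -, rfl⟩
    exact hGX.image _
  refine hf.subset fun g hg => ?_
  exact ⟨_, ⟨g, hg, rfl⟩, 1, h1, mul_one g⟩

theorem units_hom_trivial [IsAlgClosed k] [CharZero k] {A : Type*} [Group A] (f : kˣ →* A)
    (hf : (Set.range f).Finite) (t : kˣ) : f t = 1 := by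
  have : Finite f.range := hf
  have hc : 0 < Nat.card f.range := Nat.card_pos
  obtain ⟨s, hs⟩ := IsAlgClosed.exists_pow_nat_eq (t : k) hc
  have hs0 : s ≠ 0 := by
    rintro rfl
    rw [zero_pow hc.ne'] at hs
    exact t.ne_zero hs.symm
  have e : t = (Units.mk0 s hs0) ^ Nat.card f.range := by
    apply Units.ext; rw [Units.val_pow_eq_pow_val, Units.val_mk0, hs]
  have h2 : (⟨f (Units.mk0 s hs0), _, rfl⟩ : f.range) ^ Nat.card f.range = 1 := pow_card_eq_one'
  rw [e, map_pow]
  exact congrArg Subtype.val h2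

theorem proper_imp [IsAlgClosed k] [CharZero k] {G : AlgGroup k} {m : ℕ} (X : GVariety G m)
    {x : Fin m → k} (hx : x ∈ X.carrier) (h : ProperlyStable X x) : OnePSStable X x := by
  refine ⟨h.1, fun lam hlam hin => hlam ?_⟩
  obtain ⟨y, hyX, q, hq, hy⟩ := hin
  -- the limit lies in the orbit
  have hyO : y ∈ orbitSet X x := by
    obtain ⟨I, hI⟩ := h.1
    rw [hI]
    intro f hf
    let P : Polynomial k := MvPolynomial.aeval q f
    have hP : ∀ s : k, P.eval s = MvPolynomial.eval (fun i => (q i).eval s) f := by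
      intro s
      have : (Polynomial.aeval s).comp (MvPolynomial.aeval q) =
          (MvPolynomial.aeval (fun i => (q i).eval s) : MvPolynomial (Fin m) k →ₐ[k] k) := by
        ext i; simp [Polynomial.coe_aeval_eq_eval]
      have := DFunLike.congr_fun this f
      simpa [P, Polynomial.coe_aeval_eq_eval, MvPolynomial.aeval_eq_eval] using this
    have hP0 : Polynomial.X * P = 0 := by
      apply Polynomial.funext
      intro s
      rw [Polynomial.eval_mul, Polynomial.eval_X, Polynomial.eval_zero]
      by_cases hs : s = 0
      · rw [hs, zero_mul]
      · have h1 : X.act (lam.toFun (Units.mk0 s hs)) x ∈ orbitSet X x := ⟨_, lam.mem _, rfl⟩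
        rw [hI] at h1
        have h2 := h1 f hf
        rw [show X.act (lam.toFun (Units.mk0 s hs)) x = fun i => (q i).eval s from
          funext fun i => hq _ i] at h2
        rw [hP, h2, mul_zero]
    have hP1 : P = 0 := (mul_eq_zero.mp hP0).resolve_left Polynomial.X_ne_zero
    rw [show y = fun i => (q i).eval 0 from funext hy, ← hP, hP1, Polynomial.eval_zero]
  -- the limit is fixed
  have hfix : ∀ t : kˣ, X.act (lam.toFun t) y = y := by
    intro t
    obtain ⟨p, hp⟩ := X.regular
    funext i
    let φ : MvPolynomial ((Fin G.n × Fin G.n) ⊕ (Unit ⊕ Fin m)) k →ₐ[k] Polynomial k :=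
      MvPolynomial.aeval (Sum.elim
        (fun ij => Polynomial.C (mat2pt (lam.toFun t : Matrix (Fin G.n) (Fin G.n) k) ij))
        (Sum.elim (fun _ => Polynomial.C
          (((lam.toFun t)⁻¹ : GL (Fin G.n) k) : Matrix (Fin G.n) (Fin G.n) k).det) q))
    have hφ : ∀ s : k, (φ (p i)).eval s = MvPolynomial.eval
        (Sum.elim (mat2pt (lam.toFun t : Matrix (Fin G.n) (Fin G.n) k))
            (Sum.elim
              (fun _ => (((lam.toFun t)⁻¹ : GL (Fin G.n) k) : Matrix (Fin G.n) (Fin G.n) k).det)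
              (fun j => (q j).eval s))) (p i) := by
      intro s
      have : (Polynomial.aeval s).comp φ = (MvPolynomial.aeval
        (Sum.elim (mat2pt (lam.toFun t : Matrix (Fin G.n) (Fin G.n) k))
            (Sum.elim
              (fun _ => (((lam.toFun t)⁻¹ : GL (Fin G.n) k) : Matrix (Fin G.n) (Fin G.n) k).det)
              (fun j => (q j).eval s))) :
              MvPolynomial ((Fin G.n × Fin G.n) ⊕ (Unit ⊕ Fin m)) k →ₐ[k] k) := by
        ext v
        rcases v with v | u | j
        · simp [φ]
        · simp [φ]
        · simp [φ, Polynomial.coe_aeval_eq_eval]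
      have := DFunLike.congr_fun this (p i)
      simpa [Polynomial.coe_aeval_eq_eval, MvPolynomial.aeval_eq_eval] using this
    have hpol : Polynomial.X * (φ (p i) - (q i).comp (Polynomial.C (t : k) * Polynomial.X)) = 0 := by
      apply Polynomial.funext
      intro s
      rw [Polynomial.eval_mul, Polynomial.eval_X, Polynomial.eval_zero]
      by_cases hs : s = 0
      · rw [hs, zero_mul]
      · have e1 := hp _ (lam.mem t) _ (X.act_mem _ (lam.mem (Units.mk0 s hs)) x hx) i
        rw [show X.act (lam.toFun (Units.mk0 s hs)) x = fun i => (q i).eval s from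
          funext fun i => hq _ i, ← hφ] at e1
        have e2 := hq (t * Units.mk0 s hs) i
        rw [map_mul, X.act_mul _ (lam.mem t) _ (lam.mem _) x hx,
          show X.act (lam.toFun (Units.mk0 s hs)) x = fun i => (q i).eval s from
          funext fun i => hq _ i, e1] at e2
        rw [Polynomial.eval_sub, Polynomial.eval_comp, e2]
        simp
    have hpol1 := sub_eq_zero.mp ((mul_eq_zero.mp hpol).resolve_left Polynomial.X_ne_zero)
    have e3 := hp _ (lam.mem t) y hyX i
    rw [e3]
    have e4 := congrArg (Polynomial.eval 0) hpol1
    rw [hφ, Polynomial.eval_comp] at e4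
    rw [show y = fun i => (q i).eval 0 from funext hy, e4]
    simp
  obtain ⟨g, hg, hgy⟩ := hyO
  have hgi := G.toSubgroup.inv_mem hg
  have hgx : X.act g⁻¹ y = x := by
    rw [hgy, ← X.act_mul _ hgi _ hg x hx, inv_mul_cancel, X.act_one x hx]
  have hst : ∀ t, g⁻¹ * lam.toFun t * g ∈ stabSet X x := by
    intro t
    refine ⟨G.toSubgroup.mul_mem (G.toSubgroup.mul_mem hgi (lam.mem t)) hg, ?_⟩
    rw [X.act_mul _ (G.toSubgroup.mul_mem hgi (lam.mem t)) _ hg x hx, ← hgy,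
      X.act_mul _ hgi _ (lam.mem t) y hyX, hfix, hgx]
  have hfin : (Set.range lam.toFun).Finite := by
    refine (h.2.image (fun u => g * u * g⁻¹)).subset ?_
    rintro _ ⟨t, rfl⟩
    exact ⟨_, hst t, by group⟩
  intro t
  rw [units_hom_trivial lam.toFun hfin t]
  exact ⟨G.toSubgroup.one_mem, fun y hy => X.act_one y hy⟩

end easy

/-- Corollary 3.16 of the paper. If `G_X` is finite, then
for any `x ∈ X` the notions stable, properly stable and 1PS stable are all
equivalent. -/
theorem stable_properlyStable_onePSStable_equiv
    {k : Type} [Field k] [IsAlgClosed k] [CharZero k]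
    (G : AlgGroup k) (hG : IsReductive G)
    {m : ℕ} (X : GVariety G m) (hGX : (actionCenter X).Finite)
    (x : Fin m → k) (hx : x ∈ X.carrier) :
    (Stable X x ↔ ProperlyStable X x) ∧ (Stable X x ↔ OnePSStable X x) := by
  refine ⟨stable_iff X hGX x, ?_⟩
  rw [stable_iff X hGX x]
  exact ⟨proper_imp X hx, fun h => ⟨h.1, stab_finite G hG X hGX hx h⟩⟩

end PaperGIT
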